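/- arXiv:2111.14216 — 3 statements merged into one kernel-verified Lean document; each statement's English description precedes it below -/
import Mathlib

section
/- Let f(z) = P(z)/q(z) be a rational ℂ^{m×m}-valued Pick function in d variables, where P and q are coprime polynomials. Define the polynomials P₁(z) = [P(z) − P(z̄)*]/(2i), P₂(z) = [P(z) + P(z̄)*]/2, q₁(z) = [q(z) − conj(q(z̄))]/(2i), q₂(z) = [q(z) + conj(q(z̄))]/2. Then g(z₀, z) = (z₀P₁(z) + P₂(z))/(z₀q₁(z) + q₂(z)) is a rational Cayley inner function of the Pick class in d+1 variables (class ℐ𝒫_{d+1}^{m×m}), and g(i, z) = f(z). -/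
open Matrix MvPolynomial
open scoped ComplexOrder

noncomputable section

/-- The open upper poly-half-plane (coordinates indexed by `ι`). -/
def UHP (ι : Type*) : Set (ι → ℂ) := {z | ∀ k, 0 < (z k).im}

/-- `(M - Mᴴ)/(2i)`. -/
def imPart {n : Type*} (M : Matrix n n ℂ) : Matrix n n ℂ :=
  (2 * Complex.I)⁻¹ • (M - Mᴴ)

/-- Conjugation of the coefficients of a polynomial; `eval z (conjPoly p) = conj (p(z̄))`. -/
def conjPoly {d : ℕ} (p : MvPolynomial (Fin d) ℂ) : MvPolynomial (Fin d) ℂ :=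
  MvPolynomial.map (starRingEnd ℂ) p

theorem Polynomial.norm_eval_neg_I_le (H : Polynomial ℂ)
    (hH : ∀ t : ℂ, 0 < t.im → H.eval t ≠ 0) :
    ‖H.eval (-Complex.I)‖ ≤ ‖H.eval Complex.I‖ := by
  have hs : H.Splits := IsAlgClosed.splits H
  have hev : ∀ t, H.eval t = H.leadingCoeff * (H.roots.map fun a => t - a).prod := by
    intro t
    conv_lhs => rw [hs.eq_prod_roots]
    simp [Polynomial.eval_multiset_prod, Multiset.map_map]
  have hroots : ∀ a ∈ H.roots, a.im ≤ 0 := by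
    intro a ha
    by_contra! h
    exact hH a h (Polynomial.isRoot_of_mem_roots ha)
  have hprod : ∀ s : Multiset ℂ, (∀ a ∈ s, a.im ≤ 0) →
      ‖(s.map fun a => -Complex.I - a).prod‖ ≤ ‖(s.map fun a => Complex.I - a).prod‖ := by
    intro s
    induction s using Multiset.induction_on with
    | empty => simp
    | cons a s ih =>
      intro h
      simp only [Multiset.map_cons, Multiset.prod_cons, norm_mul]
      have h1 : ‖-Complex.I - a‖ ≤ ‖Complex.I - a‖ := by
        have := h a (Multiset.mem_cons_self a s)
        rw [← sq_le_sq₀ (norm_nonneg _) (norm_nonneg _), ← Complex.normSq_eq_norm_sq,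
          ← Complex.normSq_eq_norm_sq, Complex.normSq_apply, Complex.normSq_apply]
        simp
        nlinarith
      gcongr
      exact ih fun b hb => h b (Multiset.mem_cons_of_mem hb)
  rw [hev, hev, norm_mul, norm_mul]
  gcongr
  exact hprod _ hroots

/-- A polynomial without zeros on the upper poly-half-plane is dominated there by its values
at the conjugate points. -/
theorem norm_eval_conj_le_of_ne_zero_on_UHP {σ : Type*} (h : MvPolynomial σ ℂ)
    (hh : ∀ z ∈ UHP σ, eval z h ≠ 0) {z : σ → ℂ} (hz : z ∈ UHP σ) :
    ‖eval (fun k => star (z k)) h‖ ≤ ‖eval z h‖ := by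
  let H : Polynomial ℂ := aeval
    (fun k => Polynomial.C ((z k).re : ℂ) + Polynomial.X * Polynomial.C ((z k).im : ℂ)) h
  have hev : ∀ t, H.eval t = eval (fun k => ((z k).re : ℂ) + t * ((z k).im : ℂ)) h := by
    intro t
    have := MvPolynomial.map_aeval
      (fun k => Polynomial.C ((z k).re : ℂ) + Polynomial.X * Polynomial.C ((z k).im : ℂ))
      (Polynomial.evalRingHom t) h
    rw [Polynomial.coe_evalRingHom] at this
    rw [this, MvPolynomial.eval, MvPolynomial.coe_eval₂Hom, MvPolynomial.coe_eval₂Hom]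
    congr 1
    · ext x
      simp
    · funext k
      simp
      ring
  have key := Polynomial.norm_eval_neg_I_le H fun t ht => by
    rw [hev]
    apply hh
    intro k
    simpa using mul_pos ht (hz k)
  rw [hev, hev] at key
  have e1 : (fun k => ((z k).re : ℂ) + -Complex.I * ((z k).im : ℂ)) = fun k => star (z k) := by
    funext k
    apply Complex.ext <;> simp
  have e2 : (fun k => ((z k).re : ℂ) + Complex.I * ((z k).im : ℂ)) = z := by
    funext k
    apply Complex.ext <;> simp
  rwa [e1, e2] at key

theorem Complex.add_I_mul_sub_sub_I_mul_ne_zero {w a b : ℂ} (hw : 0 < w.im) (ha : a ≠ 0)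
    (hab : ‖b‖ ≤ ‖a‖) : (w + Complex.I) * a - (w - Complex.I) * b ≠ 0 := by
  intro h
  have h1 : ‖w + Complex.I‖ * ‖a‖ = ‖w - Complex.I‖ * ‖b‖ := by
    rw [← norm_mul, ← norm_mul, sub_eq_zero.mp h]
  have h2 : ‖w - Complex.I‖ < ‖w + Complex.I‖ := by
    rw [← sq_lt_sq₀ (norm_nonneg _) (norm_nonneg _), ← Complex.normSq_eq_norm_sq,
      ← Complex.normSq_eq_norm_sq, Complex.normSq_apply, Complex.normSq_apply]
    simp
    nlinarith
  have h3 : 0 < ‖a‖ := norm_pos_iff.mpr ha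
  have h4 : ‖w - Complex.I‖ * ‖b‖ ≤ ‖w - Complex.I‖ * ‖a‖ := by gcongr
  nlinarith

/-- The Hermite–Biehler type extension of a scalar rational Pick function is a Pick function. -/
theorem im_cayley_extension_nonneg {σ : Type*} (p q : MvPolynomial σ ℂ)
    (hq : ∀ z ∈ UHP σ, eval z q ≠ 0) (hpq : ∀ z ∈ UHP σ, 0 ≤ (eval z p / eval z q).im)
    {z : σ → ℂ} (hz : z ∈ UHP σ) {w : ℂ} (hw : 0 < w.im) :
    0 ≤ (((w + Complex.I) * eval z p
        - (w - Complex.I) * star (eval (fun k => star (z k)) p)) /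
      ((w + Complex.I) * eval z q
        - (w - Complex.I) * star (eval (fun k => star (z k)) q))).im := by
  have hD := Complex.add_I_mul_sub_sub_I_mul_ne_zero hw (hq z hz)
    (b := star (eval (fun k => star (z k)) q))
    (by rw [norm_star]; exact norm_eval_conj_le_of_ne_zero_on_UHP q hq hz)
  set D := (w + Complex.I) * eval z q
    - (w - Complex.I) * star (eval (fun k => star (z k)) q) with hDdef
  set N := (w + Complex.I) * eval z p
    - (w - Complex.I) * star (eval (fun k => star (z k)) p) with hNdef
  by_contra! hneg
  let h : MvPolynomial (Option σ) ℂ := rename some p + X none * rename some q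
  have hev : ∀ v : Option σ → ℂ,
      eval v h = eval (v ∘ some) p + v none * eval (v ∘ some) q := by
    intro v
    simp [h, eval_rename]
  have hh : ∀ v ∈ UHP (Option σ), eval v h ≠ 0 := by
    intro v hv h0
    have hv' : v ∘ some ∈ UHP σ := fun k => hv (some k)
    rw [hev] at h0
    have h1 : eval (v ∘ some) p / eval (v ∘ some) q = -v none := by
      rw [div_eq_iff (hq _ hv')]
      linear_combination h0
    have h2 := hpq _ hv'
    rw [h1, Complex.neg_im] at h2
    have := hv none
    linarith
  let v : Option σ → ℂ := fun o => o.elim (-(N / D)) z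
  have hv : v ∈ UHP (Option σ) := by
    rintro (_ | k)
    · simpa [v] using hneg
    · exact hz k
  have key := Complex.add_I_mul_sub_sub_I_mul_ne_zero hw (hh v hv)
    (b := star (eval (fun k => star (v k)) h))
    (by rw [norm_star]; exact norm_eval_conj_le_of_ne_zero_on_UHP h hh hv)
  apply key
  have e1 : v ∘ some = z := rfl
  have e2 : (fun k => star (v k)) ∘ some = fun k => star (z k) := rfl
  have e3 : v none = -(N / D) := rfl
  rw [hev, hev, e1, e2, star_add, star_mul', star_star, e3]
  have : N / D * D = N := div_mul_cancel₀ _ hD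
  linear_combination hNdef - this - (N / D) * hDdef

theorem dotProduct_imPart_mulVec {n : Type*} [Fintype n] (M : Matrix n n ℂ) (u : n → ℂ) :
    star u ⬝ᵥ (imPart M *ᵥ u) = ((star u ⬝ᵥ (M *ᵥ u)).im : ℂ) := by
  have h : star u ⬝ᵥ (Mᴴ *ᵥ u) = star (star u ⬝ᵥ (M *ᵥ u)) := by
    rw [star_dotProduct, star_mulVec, ← dotProduct_mulVec]
    rw [conjTranspose_conjTranspose]
  rw [imPart, smul_mulVec, dotProduct_smul, sub_mulVec, dotProduct_sub, h, Complex.im_eq_sub_conj]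
  simp only [smul_eq_mul, Complex.star_def]
  ring

theorem imPart_posSemidef_iff {n : Type*} [Fintype n] (M : Matrix n n ℂ) :
    (imPart M).PosSemidef ↔ ∀ u : n → ℂ, 0 ≤ (star u ⬝ᵥ (M *ᵥ u)).im := by
  rw [posSemidef_iff_dotProduct_mulVec]
  constructor
  · intro h u
    have := h.2 u
    rwa [dotProduct_imPart_mulVec, Complex.zero_le_real] at this
  · intro h
    refine ⟨?_, fun u => ?_⟩
    · ext i j
      simp [imPart]
      ring
    · rw [dotProduct_imPart_mulVec, Complex.zero_le_real]
      exact h u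

theorem isPreconnected_UHP (ι : Type*) : IsPreconnected (UHP ι) := by
  have : UHP ι = Set.univ.pi fun _ => {z : ℂ | 0 < z.im} := by
    ext z; simp [UHP]
  rw [this]
  exact (convex_pi fun _ _ => convex_halfSpace_im_gt 0).isPreconnected

theorem isOpen_UHP (ι : Type*) [Finite ι] : IsOpen (UHP ι) := by
  have : UHP ι = Set.univ.pi fun _ => {z : ℂ | 0 < z.im} := by
    ext z; simp [UHP]
  rw [this]
  exact isOpen_set_pi Set.finite_univ fun _ _ => isOpen_lt continuous_const Complex.continuous_im

/-- A scalar Pick function with an interior zero vanishes identically. -/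
theorem eqOn_zero_of_im_nonneg {ι : Type*} [Fintype ι] {φ : (ι → ℂ) → ℂ}
    (hφ : DifferentiableOn ℂ φ (UHP ι)) (him : ∀ z ∈ UHP ι, 0 ≤ (φ z).im)
    {z₀ : ι → ℂ} (hz₀ : z₀ ∈ UHP ι) (h0 : φ z₀ = 0) : ∀ z ∈ UHP ι, φ z = 0 := by
  have hne : ∀ z ∈ UHP ι, φ z + Complex.I ≠ 0 := by
    intro z hz h
    have h1 := congrArg Complex.im h
    have h2 := him z hz
    simp at h1
    linarith
  have hd : DifferentiableOn ℂ (fun z => (φ z - Complex.I) / (φ z + Complex.I)) (UHP ι) :=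
    by
    simp only [div_eq_mul_inv]
    exact (hφ.sub_const _).mul ((hφ.add_const _).inv hne)
  have hmax : IsMaxOn (norm ∘ fun z => (φ z - Complex.I) / (φ z + Complex.I)) (UHP ι) z₀ := by
    intro z hz
    have h2 := him z hz
    have h3 : ‖φ z - Complex.I‖ ≤ ‖φ z + Complex.I‖ := by
      rw [← sq_le_sq₀ (norm_nonneg _) (norm_nonneg _), ← Complex.normSq_eq_norm_sq,
        ← Complex.normSq_eq_norm_sq, Complex.normSq_apply, Complex.normSq_apply]
      simp
      nlinarith
    simp only [Set.mem_ofPred_eq, Function.comp_apply, h0, norm_div]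
    simp only [zero_sub, zero_add, norm_neg, Complex.norm_I, div_one]
    exact div_le_one_of_le₀ h3 (norm_nonneg _)
  intro z hz
  have key := Complex.eqOn_of_isPreconnected_of_isMaxOn_norm (isPreconnected_UHP ι)
    (isOpen_UHP ι) hd hz₀ hmax hz
  simp only [Function.const_apply, h0, zero_sub, zero_add, neg_div,
    div_self Complex.I_ne_zero] at key
  rw [div_eq_iff (hne z hz)] at key
  linear_combination key / 2

theorem Matrix.eq_zero_of_dotProduct_mulVec_self {n : Type*} [Fintype n] (M : Matrix n n ℂ)
    (h : ∀ u : n → ℂ, star u ⬝ᵥ (M *ᵥ u) = 0) : M = 0 := by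
  classical
  have h1 : Matrix.toEuclideanLin M = 0 := by
    rw [← inner_map_self_eq_zero]
    intro x
    rw [← inner_conj_symm, EuclideanSpace.inner_eq_star_dotProduct, dotProduct_comm]
    have := h x.ofLp
    simpa using this
  exact (map_eq_zero_iff _ (Matrix.toEuclideanLin).injective).mp h1

theorem eq_zero_of_eval_eq_zero_on_UHP {d : ℕ} (p : MvPolynomial (Fin d) ℂ)
    (h : ∀ z ∈ UHP (Fin d), eval z p = 0) : p = 0 := by
  refine MvPolynomial.funext_set (fun _ => {z : ℂ | 0 < z.im}) (fun _ => ?_) fun z hz => ?_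
  · refine Set.infinite_of_injective_forall_mem
      (f := fun n : ℕ => ((n : ℂ) + 1) * Complex.I) (fun a b hab => ?_) fun n => ?_
    · simpa using hab
    · simp
      positivity
  · rw [map_zero]
    exact h z fun k => hz k (Set.mem_univ k)

theorem eval_conjPoly {d : ℕ} (p : MvPolynomial (Fin d) ℂ) (z : Fin d → ℂ) :
    eval z (conjPoly p) = star (eval (fun k => star (z k)) p) := by
  induction p using MvPolynomial.induction_on with
  | C a => simp [conjPoly]
  | add p q hp hq => simp_all [conjPoly]
  | mul_X p k hp => simp_all [conjPoly]

theorem dotProduct_mulVec_eq_sum {n : Type*} [Fintype n] (M : Matrix n n ℂ) (u : n → ℂ) :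
    star u ⬝ᵥ (M *ᵥ u) = ∑ i, ∑ j, star (u i) * u j * M i j := by
  simp only [dotProduct, mulVec, Finset.mul_sum, Pi.star_apply]
  exact Finset.sum_congr rfl fun i _ => Finset.sum_congr rfl fun j _ => by ring

/-- The denominator of a rational Pick function in lowest terms is zero or has no zeros on the
upper poly-half-plane. -/
theorem denominator_ne_zero_on_UHP {d m : ℕ}
    (P : Matrix (Fin m) (Fin m) (MvPolynomial (Fin d) ℂ)) (q : MvPolynomial (Fin d) ℂ)
    (hcop : ∀ r : MvPolynomial (Fin d) ℂ, (∀ i j, r ∣ P i j) → r ∣ q → IsUnit r)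
    (f : (Fin d → ℂ) → Matrix (Fin m) (Fin m) ℂ)
    (hfdef : ∀ z, f z = (eval z q)⁻¹ • Matrix.of fun i j => eval z (P i j))
    (hfhol : ∀ i j, DifferentiableOn ℂ (fun z => f z i j) (UHP (Fin d)))
    (hfpick : ∀ z ∈ UHP (Fin d), (imPart (f z)).PosSemidef) (hq : q ≠ 0) :
    ∀ z ∈ UHP (Fin d), eval z q ≠ 0 := by
  intro z₀ hz₀ h0
  have hf0 : ∀ z ∈ UHP (Fin d), f z = 0 := by
    intro z hz
    refine Matrix.eq_zero_of_dotProduct_mulVec_self _ fun u => ?_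
    refine eqOn_zero_of_im_nonneg (φ := fun z => star u ⬝ᵥ (f z *ᵥ u)) ?_
      (fun z hz => (imPart_posSemidef_iff _).mp (hfpick z hz) u) hz₀ ?_ z hz
    · simp only [dotProduct_mulVec_eq_sum]
      exact DifferentiableOn.fun_sum fun i _ => DifferentiableOn.fun_sum fun j _ =>
        (hfhol i j).const_mul _
    · simp [hfdef, h0]
  have hP : ∀ i j, P i j = 0 := by
    intro i j
    have : P i j * q = 0 := by
      refine eq_zero_of_eval_eq_zero_on_UHP _ fun z hz => ?_
      have h1 := congrFun (congrFun (hf0 z hz) i) j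
      rw [hfdef] at h1
      simp at h1
      rw [map_mul, mul_eq_zero]
      exact h1.symm
    exact (mul_eq_zero.mp this).resolve_right hq
  have hu : IsUnit q := hcop q (fun i j => by simp [hP i j]) dvd_rfl
  exact (hu.map (eval z₀)).ne_zero h0

/-- every rational matrix-valued Pick function `f = P/q` in `d` variables is
obtained (by evaluating `z₀ = i`) from a rational Cayley inner Pick function
`g(z₀,z) = (z₀P₁(z)+P₂(z))/(z₀q₁(z)+q₂(z))` in `d+1` variables. -/
theorem cayley_inner_extension (d m : ℕ)
    (P : Matrix (Fin m) (Fin m) (MvPolynomial (Fin d) ℂ))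
    (q : MvPolynomial (Fin d) ℂ)
    (hcop : ∀ r : MvPolynomial (Fin d) ℂ, (∀ i j, r ∣ P i j) → r ∣ q → IsUnit r)
    (f : (Fin d → ℂ) → Matrix (Fin m) (Fin m) ℂ)
    (hfdef : ∀ z, f z = (eval z q)⁻¹ • Matrix.of fun i j => eval z (P i j))
    -- `f` belongs to the Pick class `𝒫_d^{m×m}` :
    (hfhol : ∀ i j, DifferentiableOn ℂ (fun z => f z i j) (UHP (Fin d)))
    (hfpick : ∀ z ∈ UHP (Fin d), (imPart (f z)).PosSemidef)
    -- the polynomials `P₁, P₂, q₁, q₂` :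
    (P1 P2 : Matrix (Fin m) (Fin m) (MvPolynomial (Fin d) ℂ))
    (q1 q2 : MvPolynomial (Fin d) ℂ)
    (hP1 : ∀ i j, P1 i j = (2 * Complex.I)⁻¹ • (P i j - conjPoly (P j i)))
    (hP2 : ∀ i j, P2 i j = (2 : ℂ)⁻¹ • (P i j + conjPoly (P j i)))
    (hq1 : q1 = (2 * Complex.I)⁻¹ • (q - conjPoly q))
    (hq2 : q2 = (2 : ℂ)⁻¹ • (q + conjPoly q))
    -- the function `g(z₀, z) = (z₀P₁(z)+P₂(z)) / (z₀q₁(z)+q₂(z))` on `ℂ^{d+1}` :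
    (g : (Fin (d + 1) → ℂ) → Matrix (Fin m) (Fin m) ℂ)
    (hgdef : ∀ w, g w = (w 0 * eval (w ∘ Fin.succ) q1 + eval (w ∘ Fin.succ) q2)⁻¹ •
      Matrix.of fun i j =>
        w 0 * eval (w ∘ Fin.succ) (P1 i j) + eval (w ∘ Fin.succ) (P2 i j)) :
    -- `g` belongs to the Pick class `𝒫_{d+1}^{m×m}` :
    (∀ i j, DifferentiableOn ℂ (fun w => g w i j) (UHP (Fin (d + 1)))) ∧
    (∀ w ∈ UHP (Fin (d + 1)), (imPart (g w)).PosSemidef) ∧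
    -- `g` is Cayley inner: it takes Hermitian values at real points where it is defined :
    (∀ x : Fin (d + 1) → ℝ,
      (x 0 : ℂ) * eval (fun k => (x k.succ : ℂ)) q1 + eval (fun k => (x k.succ : ℂ)) q2 ≠ 0 →
      (g fun k => (x k : ℂ)).IsHermitian) ∧
    -- `g(i, z) = f(z)` :
    (∀ z : Fin d → ℂ, g (Fin.cons Complex.I z) = f z) := by
  have hD : ∀ (w : ℂ) z, w * eval z q1 + eval z q2 = (2 * Complex.I)⁻¹ *
      ((w + Complex.I) * eval z q - (w - Complex.I) * star (eval (fun k => star (z k)) q)) := by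
    intro w z
    simp only [hq1, hq2, smul_eval, map_sub, map_add, eval_conjPoly]
    field_simp
    ring
  have hN : ∀ (w : ℂ) z i j, w * eval z (P1 i j) + eval z (P2 i j) = (2 * Complex.I)⁻¹ *
      ((w + Complex.I) * eval z (P i j)
        - (w - Complex.I) * star (eval (fun k => star (z k)) (P j i))) := by
    intro w z i j
    simp only [hP1, hP2, smul_eval, map_sub, map_add, eval_conjPoly]
    field_simp
    ring
  have hI : (2 * Complex.I)⁻¹ ≠ 0 := by simp
  have hsucc : ∀ w ∈ UHP (Fin (d + 1)), w ∘ Fin.succ ∈ UHP (Fin d) := fun w hw k => hw k.succ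
  refine ⟨?_, ?_, ?_, ?_⟩
  · intro i j
    by_cases hq : q = 0
    · have : (fun w => g w i j) = fun _ => 0 := by
        funext w
        simp [hgdef, hD, hq]
      rw [this]
      exact differentiableOn_const 0
    · have hne := denominator_ne_zero_on_UHP P q hcop f hfdef hfhol hfpick hq
      have hpoly : ∀ p : MvPolynomial (Fin d) ℂ,
          Differentiable ℂ fun w : Fin (d + 1) → ℂ => eval (w ∘ Fin.succ) p := by
        intro p
        induction p using MvPolynomial.induction_on with
        | C a => simp
        | add p q hp hq => simpa using hp.fun_add hq
        | mul_X p k hp => simpa using hp.fun_mul (differentiable_apply k.succ)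
      have h0 : Differentiable ℂ fun w : Fin (d + 1) → ℂ => w 0 := differentiable_apply 0
      simp only [hgdef, Matrix.smul_apply, Matrix.of_apply, smul_eq_mul]
      refine DifferentiableOn.mul (DifferentiableOn.inv ?_ fun w hw => ?_) ?_
      · exact ((h0.mul (hpoly q1)).add (hpoly q2)).differentiableOn
      · rw [hD]
        refine mul_ne_zero hI (Complex.add_I_mul_sub_sub_I_mul_ne_zero (hw 0)
          (hne _ (hsucc w hw)) ?_)
        rw [norm_star]
        exact norm_eval_conj_le_of_ne_zero_on_UHP q hne (hsucc w hw)
      · exact ((h0.mul (hpoly _)).add (hpoly _)).differentiableOn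
  · intro w hw
    rw [imPart_posSemidef_iff]
    intro u
    by_cases hq : q = 0
    · have : g w = 0 := by
        rw [hgdef, hD]
        simp [hq]
      simp [this]
    · have hne := denominator_ne_zero_on_UHP P q hcop f hfdef hfhol hfpick hq
      let p : MvPolynomial (Fin d) ℂ := ∑ i, ∑ j, C (star (u i) * u j) * P i j
      have hp : ∀ z, eval z p = ∑ i, ∑ j, star (u i) * u j * eval z (P i j) := by
        intro z
        simp [p]
      have hp' : ∀ z, star (eval z p) =
          ∑ i, ∑ j, star (u i) * u j * star (eval z (P j i)) := by
        intro z
        rw [hp, Finset.sum_comm]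
        simp only [star_sum, star_mul', star_star]
        exact Finset.sum_congr rfl fun i _ => Finset.sum_congr rfl fun j _ => by ring
      have key := im_cayley_extension_nonneg p q hne (fun z hz => ?_) (hsucc w hw) (hw 0)
      · convert key using 2
        rw [hgdef, dotProduct_mulVec_eq_sum, hD]
        simp only [Matrix.smul_apply, Matrix.of_apply, smul_eq_mul, hN]
        rw [hp', hp, Finset.mul_sum, Finset.mul_sum, ← Finset.sum_sub_distrib, Finset.sum_div]
        refine Finset.sum_congr rfl fun i _ => ?_
        rw [Finset.mul_sum, Finset.mul_sum, ← Finset.sum_sub_distrib, Finset.sum_div]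
        refine Finset.sum_congr rfl fun j _ => ?_
        rw [mul_inv, inv_inv, div_eq_mul_inv]
        field_simp
      · have h1 := (imPart_posSemidef_iff _).mp (hfpick z hz) u
        convert h1 using 2
        rw [hfdef, dotProduct_mulVec_eq_sum, hp, Finset.sum_div]
        refine Finset.sum_congr rfl fun i _ => ?_
        rw [Finset.sum_div]
        refine Finset.sum_congr rfl fun j _ => ?_
        simp only [Matrix.smul_apply, Matrix.of_apply, smul_eq_mul]
        ring
  · intro x _
    have hx : (fun k => star (((fun k => (x k : ℂ)) ∘ Fin.succ : Fin d → ℂ) k)) =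
        (fun k => (x k : ℂ)) ∘ Fin.succ := by
      funext k
      simp
    have hstar : ∀ a b : ℂ, star ((2 * Complex.I)⁻¹ *
        (((x 0 : ℂ) + Complex.I) * a - ((x 0 : ℂ) - Complex.I) * star b)) =
        (2 * Complex.I)⁻¹ *
          (((x 0 : ℂ) + Complex.I) * b - ((x 0 : ℂ) - Complex.I) * star a) := by
      intro a b
      simp only [star_mul', star_inv₀, star_sub, star_add, Complex.star_def,
        Complex.conj_ofReal, Complex.conj_I, map_ofNat, Complex.conj_conj]
      field_simp
      ring
    ext i j
    rw [Matrix.conjTranspose_apply, hgdef, Matrix.smul_apply, Matrix.smul_apply,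
      Matrix.of_apply, Matrix.of_apply, hD, hN, hN, hx, smul_eq_mul, smul_eq_mul, star_mul',
      star_inv₀, hstar, hstar]
  · intro z
    have h1 : (Fin.cons Complex.I z : Fin (d + 1) → ℂ) ∘ Fin.succ = z := by
      funext k
      simp
    have h2 : ∀ a : ℂ, (2 * Complex.I)⁻¹ * ((Complex.I + Complex.I) * a) = a := by
      intro a
      field_simp
      ring
    ext i j
    rw [hgdef, hfdef, h1, Matrix.smul_apply, Matrix.smul_apply, Matrix.of_apply,
      Matrix.of_apply, Fin.cons_zero, hD, hN]
    simp only [sub_self, zero_mul, sub_zero, h2]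
end
end

section
/- A rational multi-affine ℂ^{m×m}-valued function f(z) = P(z)/q(z) belongs to the Cayley inner Pick class ℐ𝒫_d^{m×m} if and only if all partial Wronskians W_k[q, P](z) = q(z)·∂P/∂z_k(z) − P(z)·∂q/∂z_k(z), k = 1, …, d, are positive semidefinite (PSD) matrix-valued polynomials. -/
open Matrix MvPolynomial
open scoped ComplexOrder

noncomputable section

/-- The partial Wronskian `W_k[q,P] = q ∂P/∂z_k − P ∂q/∂z_k` (a matrix of polynomials). -/
def wronskian {d m : ℕ} (q : MvPolynomial (Fin d) ℂ)
    (P : Matrix (Fin m) (Fin m) (MvPolynomial (Fin d) ℂ)) (k : Fin d) :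
    Matrix (Fin m) (Fin m) (MvPolynomial (Fin d) ℂ) :=
  Matrix.of fun i j => q * pderiv k (P i j) - P i j * pderiv k q

section Lines

variable {d : ℕ}

lemma eval_add_single {p : MvPolynomial (Fin d) ℂ} {k : Fin d} (hp : p.degreeOf k ≤ 1)
    (z : Fin d → ℂ) (w : ℂ) :
    eval (z + Pi.single k w) p = eval z p + w * eval z (pderiv k p) := by
  have monomial_case : ∀ (s : Fin d →₀ ℕ) (c : ℂ), s k ≤ 1 →
      eval (z + Pi.single k w) (monomial s c) =
        eval z (monomial s c) + w * eval z (pderiv k (monomial s c)) := by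
    intro s c hs
    have hprod : ∏ i ∈ {k}ᶜ, (z + Pi.single k w : Fin d → ℂ) i ^ s i = ∏ i ∈ {k}ᶜ, z i ^ s i := by
      refine Finset.prod_congr rfl fun i hi => ?_
      have hik : i ≠ k := by simpa using hi
      simp [hik]
    have hprod' : ∏ i ∈ {k}ᶜ, z i ^ (s - Finsupp.single k 1 : Fin d →₀ ℕ) i = ∏ i ∈ {k}ᶜ, z i ^ s i := by
      refine Finset.prod_congr rfl fun i hi => ?_
      have hik : k ≠ i := by
        have : i ≠ k := by simpa using hi
        exact this.symm
      simp [hik]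
    rw [pderiv_monomial, eval_monomial, eval_monomial, eval_monomial]
    simp only [Finsupp.prod_fintype _ _ (fun _ => pow_zero _)]
    rw [Fintype.prod_eq_mul_prod_compl k,
      Fintype.prod_eq_mul_prod_compl k (fun i => z i ^ s i),
      Fintype.prod_eq_mul_prod_compl k (fun i => z i ^ (s - Finsupp.single k 1 : Fin d →₀ ℕ) i), hprod, hprod']
    have hcases : s k = 0 ∨ s k = 1 := by omega
    rcases hcases with h | h
    · simp [h]
    · simp [h]
      ring
  have hsum := p.support_sum_monomial_coeff
  rw [← hsum]
  simp only [map_sum, Finset.mul_sum, ← Finset.sum_add_distrib]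
  exact Finset.sum_congr rfl fun s hs => monomial_case s _ ((monomial_le_degreeOf k hs).trans hp)

lemma eval_pderiv_add_single {p : MvPolynomial (Fin d) ℂ} {k : Fin d} (hp : p.degreeOf k ≤ 1)
    (z : Fin d → ℂ) (w : ℂ) :
    eval (z + Pi.single k w) (pderiv k p) = eval z (pderiv k p) := by
  have h1 := eval_add_single hp (z + Pi.single k w) 1
  have h2 := eval_add_single hp z (w + 1)
  have h3 := eval_add_single hp z w
  rw [add_assoc, ← Pi.single_add] at h1
  linear_combination h2 - h1 - h3

lemma exists_polynomial_eval_line (p : MvPolynomial (Fin d) ℂ) (z y : Fin d → ℂ) :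
    ∃ h : Polynomial ℂ, ∀ w, h.eval w = eval (fun i => z i + w * y i) p := by
  refine ⟨eval₂ Polynomial.C (fun i => Polynomial.C (z i) + Polynomial.X * Polynomial.C (y i)) p,
    fun w => ?_⟩
  rw [polynomial_eval_eval₂]
  simp only [Polynomial.eval_add, Polynomial.eval_mul, Polynomial.eval_C, Polynomial.eval_X]
  have : (Polynomial.evalRingHom w).comp Polynomial.C = RingHom.id ℂ := by
    ext
    simp
  rw [this]
  rfl

lemma exists_real_line_avoiding_zeros {h : Polynomial ℂ} (h0 : h.eval 0 ≠ 0) :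
    ∃ t : ℝ, ∀ r : ℝ, h.eval (r * (t - Complex.I)) ≠ 0 := by
  have hne : h ≠ 0 := by
    rintro rfl
    simp at h0
  obtain ⟨t, -, ht⟩ := Set.infinite_univ.exists_notMem_finset
    (h.roots.toFinset.image fun w : ℂ => -w.re / w.im)
  refine ⟨t, fun r hr => ht ?_⟩
  have hr0 : r ≠ 0 := by
    rintro rfl
    simp at hr
    exact h0 hr
  refine Finset.mem_image.2 ⟨r * (t - Complex.I), ?_, ?_⟩
  · simpa [hne] using hr
  · simp
    field_simp

lemma eq_zero_of_eventually_eval_eq_zero {p : MvPolynomial (Fin d) ℂ} {z : Fin d → ℂ}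
    (h : ∀ᶠ x in nhds z, eval x p = 0) : p = 0 := by
  obtain ⟨ε, hε, hb⟩ := Metric.eventually_nhds_iff.1 h
  refine funext_set (fun i => Metric.ball (z i) (ε / 2)) (fun i => ?_) fun x hx => ?_
  · exact infinite_of_mem_nhds (z i) (Metric.ball_mem_nhds _ (by positivity))
  · rw [map_zero]
    apply hb
    refine (dist_pi_le_iff (by positivity)).2 (fun i => (hx i trivial).le) |>.trans_lt ?_
    linarith

lemma star_eval_ofReal {p : MvPolynomial (Fin d) ℂ} (x : Fin d → ℝ) :
    star (eval (fun t => (x t : ℂ)) p) = eval (fun t => (x t : ℂ)) (conjPoly p) := by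
  rw [conjPoly, eval_map, ← coe_eval₂Hom]
  have : (starRingEnd ℂ).comp (eval (fun t => (x t : ℂ))) =
      eval₂Hom (starRingEnd ℂ) (fun t => (x t : ℂ)) := by
    ext <;> simp
  rw [← this]
  rfl

lemma eval_ofReal_im_eq_zero {p : MvPolynomial (Fin d) ℂ} (hp : conjPoly p = p)
    (x : Fin d → ℝ) : (eval (fun t => (x t : ℂ)) p).im = 0 := by
  have h := star_eval_ofReal (p := p) x
  rw [hp] at h
  exact Complex.conj_eq_iff_im.1 h

end Lines

section Scalar

lemma sesquilinear_disc_bounds {A b C e : ℂ}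
    (h : ∀ x : ℝ, 0 ≤ ((A + x * b) * star (C + x * e)).im) :
    Complex.normSq (b * C - A * e) ≤ (b * star C - A * star e).re ^ 2 ∧
    ((0 ≤ (b * star C - A * star e).re ∨ b * C - A * e = 0) → ∀ t : ℝ, 0 ≤ t →
      0 ≤ ((A + t * Complex.I * b) * star (C + t * Complex.I * e)).im) := by
  obtain ⟨A1, A2⟩ := A
  obtain ⟨b1, b2⟩ := b
  obtain ⟨C1, C2⟩ := C
  obtain ⟨e1, e2⟩ := e
  set K : ℝ := A2 * C1 - A1 * C2 with hK
  set L : ℝ := b2 * e1 - b1 * e2 with hL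
  set R : ℝ := A2 * e1 - A1 * e2 + b2 * C1 - b1 * C2 with hR
  set M : ℝ := b1 * C1 + b2 * C2 - A1 * e1 - A2 * e2 with hM
  have hQ : ∀ x : ℝ, 0 ≤ L * (x * x) + R * x + K := by
    intro x
    have := h x
    simp at this
    simp only [hK, hL, hR]
    linarith
  have hdisc := discrim_le_zero hQ
  rw [discrim] at hdisc
  have hK0 : 0 ≤ K := by simpa using hQ 0
  have hL0 : 0 ≤ L := by
    by_contra! hneg
    have h1 := hQ (1 + (K + 1) / (-L))
    have h2 := hQ (-(1 + (K + 1) / (-L)))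
    have hs : (K + 1) / (-L) * (-L) = K + 1 := div_mul_cancel₀ _ (by linarith)
    have hs0 : 0 < (K + 1) / (-L) := by apply div_pos <;> linarith
    set s := (K + 1) / (-L)
    nlinarith [mul_pos hs0 (neg_pos.2 hneg), mul_pos hs0 hs0]
  have hDn : Complex.normSq ((⟨b1, b2⟩ : ℂ) * ⟨C1, C2⟩ - ⟨A1, A2⟩ * ⟨e1, e2⟩) =
      M ^ 2 + R ^ 2 - 4 * K * L := by
    simp only [Complex.normSq_apply, Complex.sub_re, Complex.sub_im, Complex.mul_re,
      Complex.mul_im, hM, hR, hK, hL]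
    ring
  have hMre : ((⟨b1, b2⟩ : ℂ) * star ⟨C1, C2⟩ - ⟨A1, A2⟩ * star ⟨e1, e2⟩).re = M := by
    simp [hM]
    ring
  rw [hMre]
  refine ⟨by rw [hDn]; linarith, fun hor t ht => ?_⟩
  have hval : (((⟨A1, A2⟩ : ℂ) + t * Complex.I * ⟨b1, b2⟩) *
      star ((⟨C1, C2⟩ : ℂ) + t * Complex.I * ⟨e1, e2⟩)).im = K + t * M + t ^ 2 * L := by
    simp [hM, hK, hL]
    ring
  rw [hval]
  rcases hor with hor | hor
  · positivity
  · rw [hor, map_zero] at hDn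
    rcases hL0.eq_or_lt with hL0 | hL0
    · rw [← hL0] at hDn ⊢
      have hMz : M = 0 := by nlinarith [sq_nonneg M, sq_nonneg R]
      rw [hMz]
      linarith
    · have : 0 ≤ L * (K + t * M + t ^ 2 * L) := by
        nlinarith [sq_nonneg (2 * L * t + M), sq_nonneg R]
      exact nonneg_of_mul_nonneg_right this hL0

variable {d : ℕ}

/-- For `q` nonvanishing at `z`, this is `|q(z)|² Im (p(z)/q(z))`. -/
def imForm (p q : MvPolynomial (Fin d) ℂ) (z : Fin d → ℂ) : ℝ :=
  (eval z p * star (eval z q)).im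

lemma imForm_add_single {p q : MvPolynomial (Fin d) ℂ} {k : Fin d}
    (hp : p.degreeOf k ≤ 1) (hq : q.degreeOf k ≤ 1) (z : Fin d → ℂ) (w : ℂ) :
    imForm p q (z + Pi.single k w) = ((eval z p + w * eval z (pderiv k p)) *
      star (eval z q + w * eval z (pderiv k q))).im := by
  rw [imForm, eval_add_single hp, eval_add_single hq]

lemma continuous_imForm (p q : MvPolynomial (Fin d) ℂ) : Continuous (imForm p q) :=
  Complex.continuous_im.comp
    ((MvPolynomial.continuous_eval p).mul (MvPolynomial.continuous_eval q).star)

lemma imForm_ofReal {p q : MvPolynomial (Fin d) ℂ} (hp : conjPoly p = p) (hq : conjPoly q = q)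
    (x : Fin d → ℝ) : imForm p q (fun t => (x t : ℂ)) = 0 := by
  simp [imForm, eval_ofReal_im_eq_zero hp, eval_ofReal_im_eq_zero hq]

lemma conjPoly_pderiv {p : MvPolynomial (Fin d) ℂ} (hp : conjPoly p = p) (k : Fin d) :
    conjPoly (pderiv k p) = pderiv k p := by
  conv_rhs => rw [← hp]
  exact pderiv_map.symm

lemma imForm_nonneg_of_wronskian {p q : MvPolynomial (Fin d) ℂ}
    (hp : ∀ k, p.degreeOf k ≤ 1) (hq : ∀ k, q.degreeOf k ≤ 1)
    (hpr : conjPoly p = p) (hqr : conjPoly q = q)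
    (hW : ∀ (k : Fin d) (x : Fin d → ℝ),
      0 ≤ (eval (fun t => (x t : ℂ)) (q * pderiv k p - p * pderiv k q)).re)
    (S : Finset (Fin d)) : ∀ x y : Fin d → ℝ, (∀ j, 0 ≤ y j) → (∀ j ∉ S, y j = 0) →
      0 ≤ imForm p q (fun j => x j + y j * Complex.I) := by
  induction S using Finset.induction_on with
  | empty =>
    intro x y _ hy
    have : (fun j => (x j : ℂ) + y j * Complex.I) = fun j => (x j : ℂ) := by
      ext j
      simp [hy j]
    rw [this, imForm_ofReal hpr hqr]
  | insert k S hkS ih =>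
    intro x y hy0 hyS
    set y₀ : Fin d → ℝ := Function.update y k 0 with hy₀
    have hy₀0 : ∀ j, 0 ≤ y₀ j := by
      intro j
      by_cases hj : j = k
      · simp [hy₀, hj]
      · simp [hy₀, hj, hy0 j]
    have hy₀S : ∀ j ∉ S, y₀ j = 0 := by
      intro j hjS
      by_cases hj : j = k
      · simp [hy₀, hj]
      · simp [hy₀, hj, hyS j (by simp [hj, hjS])]
    set z : Fin d → ℂ := fun j => x j + y₀ j * Complex.I with hz
    have hzy : (fun j => (x j : ℂ) + y j * Complex.I) =
        z + Pi.single k (y k * Complex.I) := by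
      ext j
      by_cases hj : j = k
      · subst hj
        simp [hz, hy₀]
      · simp [hz, hy₀, hj]
    have key : ∀ x' y' : Fin d → ℝ, (∀ j, 0 ≤ y' j) → (∀ j ∉ S, y' j = 0) → ∀ s : ℝ,
        0 ≤ ((eval (fun j => (x' j : ℂ) + y' j * Complex.I) p +
            s * eval (fun j => (x' j : ℂ) + y' j * Complex.I) (pderiv k p)) *
          star (eval (fun j => (x' j : ℂ) + y' j * Complex.I) q +
            s * eval (fun j => (x' j : ℂ) + y' j * Complex.I) (pderiv k q))).im := by
      intro x' y' h0 hS s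
      rw [← imForm_add_single (hp k) (hq k)]
      convert ih (x' + Pi.single k s) y' h0 hS using 2
      ext j
      by_cases hj : j = k
      · subst hj
        simp
        ring
      · simp [hj]
    rw [hzy, imForm_add_single (hp k) (hq k)]
    refine (sesquilinear_disc_bounds (key x y₀ hy₀0 hy₀S)).2 ?_ (y k) (hy0 k)
    rw [or_iff_not_imp_right]
    intro hD
    obtain ⟨h, hh⟩ := exists_polynomial_eval_line (q * pderiv k p - p * pderiv k q) z
      (fun j => (y₀ j : ℂ))
    have h0 : h.eval 0 ≠ 0 := by
      rw [hh]
      simp only [zero_mul, add_zero, map_sub, map_mul]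
      rwa [mul_comm (eval _ q)]
    obtain ⟨t, ht⟩ := exists_real_line_avoiding_zeros h0
    set γ : ℝ → Fin d → ℂ := fun r j => z j + r * (t - Complex.I) * y₀ j with hγ
    have hγ' : ∀ r, γ r = fun j => ((x j + r * t * y₀ j : ℝ) : ℂ) +
        ((1 - r) * y₀ j : ℝ) * Complex.I := by
      intro r
      ext j
      simp only [hγ, hz]
      push_cast
      ring
    set M : ℝ → ℝ := fun r => (eval (γ r) (pderiv k p) * star (eval (γ r) q) -
      eval (γ r) p * star (eval (γ r) (pderiv k q))).re with hM
    have hγc : Continuous γ := by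
      simp only [hγ]
      fun_prop
    have hMc : Continuous M := by
      have hc : ∀ u : MvPolynomial (Fin d) ℂ, Continuous fun r => eval (γ r) u := fun u =>
        (MvPolynomial.continuous_eval u).comp hγc
      exact Complex.continuous_re.comp
        (((hc _).mul (hc _).star).sub ((hc _).mul (hc _).star))
    have hMne : ∀ r, r ≤ 1 → M r ≠ 0 := by
      intro r hr hMr
      have hb := (sesquilinear_disc_bounds (key (fun j => x j + r * t * y₀ j)
        (fun j => (1 - r) * y₀ j) (fun j => mul_nonneg (by linarith) (hy₀0 j))
        (fun j hj => by simp [hy₀S j hj]))).1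
      rw [← hγ' r] at hb
      change _ ≤ M r ^ 2 at hb
      rw [hMr] at hb
      have hz0 := Complex.normSq_eq_zero.1
        (le_antisymm (by simpa using hb) (Complex.normSq_nonneg _))
      apply ht r
      rw [hh]
      change eval (γ r) _ = 0
      simpa [mul_comm] using hz0
    have hM1 : 0 ≤ M 1 := by
      have hγ1 : γ 1 = fun j => ((x j + t * y₀ j : ℝ) : ℂ) := by
        rw [hγ']
        simp
      have hre := hW k (fun j => x j + t * y₀ j)
      simp only [hM, hγ1]
      simp only [map_sub, map_mul] at hre
      have i1 := eval_ofReal_im_eq_zero hqr (fun j => x j + t * y₀ j)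
      have i2 := eval_ofReal_im_eq_zero hpr (fun j => x j + t * y₀ j)
      simp only [Complex.sub_re, Complex.mul_re, Complex.star_def, Complex.conj_re,
        Complex.conj_im, i1, i2] at hre ⊢
      linarith
    have hM0 : M 0 = (eval z (pderiv k p) * star (eval z q) -
        eval z p * star (eval z (pderiv k q))).re := by
      simp [hM, hγ]
    rw [← hM0]
    by_contra! hneg
    obtain ⟨r, hr, hr0⟩ := intermediate_value_Icc zero_le_one hMc.continuousOn
      (show (0 : ℝ) ∈ Set.Icc (M 0) (M 1) from ⟨hneg.le, hM1⟩)
    exact hMne r hr.2 hr0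

lemma isOpen_UHP_s6 : IsOpen (UHP (Fin d)) := by
  have : UHP (Fin d) = ⋂ k, {z : Fin d → ℂ | 0 < (z k).im} := by
    ext
    simp [UHP]
  rw [this]
  exact isOpen_iInter_of_finite fun k =>
    isOpen_lt continuous_const (Complex.continuous_im.comp (continuous_apply k))

lemma add_single_mem_UHP {z : Fin d → ℂ} (hz : z ∈ UHP (Fin d)) {k : Fin d} {w : ℂ}
    (hw : 0 < (z k + w).im) : z + Pi.single k w ∈ UHP (Fin d) := by
  intro j
  by_cases hj : j = k
  · subst hj
    simpa using hw
  · simpa [hj] using hz j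

lemma eval_eq_zero_of_imForm_nonneg {p q : MvPolynomial (Fin d) ℂ} {k : Fin d}
    (hp : p.degreeOf k ≤ 1) (hq : q.degreeOf k ≤ 1)
    (hN : ∀ z ∈ UHP (Fin d), 0 ≤ imForm p q z) {z : Fin d → ℂ} (hz : z ∈ UHP (Fin d))
    (h0 : eval z q = 0) (h1 : eval z (pderiv k q) ≠ 0) : eval z p = 0 := by
  set A := eval z p
  set b := eval z (pderiv k p)
  set e := eval z (pderiv k q)
  set g := A * star e with hg
  suffices hg0 : g = 0 by
    simpa [hg, h1] using hg0
  by_contra hgne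
  have hpos : 0 < Complex.normSq g := Complex.normSq_pos.2 hgne
  have hev : ∀ᶠ s : ℝ in nhds 0, 0 < (z k + s * (Complex.I * g)).im ∧
      s * (b * star e).im < 1 := by
    refine Filter.Eventually.and ?_ ?_
    · refine (Continuous.tendsto ?_ 0).eventually (lt_mem_nhds ?_)
      · fun_prop
      · simpa using hz k
    · refine (Continuous.tendsto ?_ 0).eventually (gt_mem_nhds ?_)
      · fun_prop
      · simp
  obtain ⟨s, ⟨hs1, hs2⟩, hs0⟩ :=
    ((hev.filter_mono nhdsWithin_le_nhds).and (self_mem_nhdsWithin (s := Set.Ioi (0 : ℝ)))).exists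
  have hs0 : 0 < s := hs0
  have h := hN _ (add_single_mem_UHP hz hs1)
  rw [imForm_add_single hp hq, h0] at h
  have hval : ((A + s * (Complex.I * g) * b) * star (0 + s * (Complex.I * g) * e)).im =
      s * Complex.normSq g * (s * (b * star e).im - 1) := by
    have : (A + s * (Complex.I * g) * b) * star (0 + s * (Complex.I * g) * e) =
        -(s * Complex.I * (g * star g)) + s ^ 2 * (g * star g) * (b * star e) := by
      simp only [Complex.star_def, map_add, map_mul, map_zero, Complex.conj_I,
        Complex.conj_ofReal, hg, Complex.conj_conj]
      linear_combination (-(s : ℂ) ^ 2 * A * starRingEnd ℂ A * e * starRingEnd ℂ e * b *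
        starRingEnd ℂ e) * Complex.I_sq
    rw [this, Complex.star_def, Complex.mul_conj]
    simp [← Complex.ofReal_pow]
    ring
  have h' : 0 ≤ s * Complex.normSq g * (s * (b * star e).im - 1) := hval ▸ h
  exact absurd h' (not_le.2 (mul_neg_of_pos_of_neg (mul_pos hs0 hpos) (by linarith)))

lemma wronskian_eq_zero_of_imForm_nonneg {p q : MvPolynomial (Fin d) ℂ} {k : Fin d}
    (hp : p.degreeOf k ≤ 1) (hq : q.degreeOf k ≤ 1)
    (hN : ∀ z ∈ UHP (Fin d), 0 ≤ imForm p q z) {z : Fin d → ℂ} (hz : z ∈ UHP (Fin d))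
    (h0 : eval z q = 0) (h1 : eval z (pderiv k q) ≠ 0) :
    q * pderiv k p - p * pderiv k q = 0 := by
  have hc : ∀ u : MvPolynomial (Fin d) ℂ, ContinuousAt (fun x => eval x u) z := fun u =>
    (MvPolynomial.continuous_eval u).continuousAt
  have e1 : ∀ᶠ x in nhds z, eval x (pderiv k q) ≠ 0 := (hc _).eventually_ne h1
  have e2 : ∀ᶠ x in nhds z, x ∈ UHP (Fin d) := isOpen_UHP_s6.mem_nhds hz
  have e3 : ∀ᶠ x in nhds z, 0 < (x k + -(eval x q / eval x (pderiv k q))).im := by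
    have hcont : ContinuousAt
        (fun x : Fin d → ℂ => (x k + -(eval x q / eval x (pderiv k q))).im) z :=
      Complex.continuous_im.continuousAt.comp
        ((continuous_apply k).continuousAt.add ((hc _).div (hc _) h1).neg)
    refine hcont.eventually (lt_mem_nhds ?_)
    simpa [h0] using hz k
  refine eq_zero_of_eventually_eval_eq_zero (z := z) ?_
  filter_upwards [e1, e2, e3] with x hx1 hx2 hx3
  have hp0 := eval_eq_zero_of_imForm_nonneg hp hq hN (add_single_mem_UHP hx2 hx3)
    (k := k) (by rw [eval_add_single hq]; field_simp; ring)
    (by rwa [eval_pderiv_add_single hq])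
  rw [eval_add_single hp] at hp0
  field_simp at hp0
  simp only [map_sub, map_mul]
  linear_combination -hp0

lemma exists_zero_with_pderiv_ne_zero {q : MvPolynomial (Fin d) ℂ}
    (hq : ∀ k, q.degreeOf k ≤ 1) (hne : q ≠ 0) {z₀ : Fin d → ℂ} (hz₀ : z₀ ∈ UHP (Fin d))
    (h0 : eval z₀ q = 0) :
    ∃ z ∈ UHP (Fin d), ∃ k, eval z q = 0 ∧ eval z (pderiv k q) ≠ 0 := by
  by_contra! hcon
  apply hne
  have hall : ∀ z ∈ UHP (Fin d), ∀ S : Finset (Fin d), eval (S.piecewise z z₀) q = 0 := by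
    intro z hz S
    induction S using Finset.induction_on with
    | empty => simpa using h0
    | insert k S hkS ih =>
      have hmem : S.piecewise z z₀ ∈ UHP (Fin d) := by
        intro j
        by_cases hj : j ∈ S
        · simpa [hj] using hz j
        · simpa [hj] using hz₀ j
      have heq : (insert k S).piecewise z z₀ =
          S.piecewise z z₀ + Pi.single k (z k - S.piecewise z z₀ k) := by
        ext j
        rw [Finset.piecewise_insert]
        by_cases hj : j = k
        · subst hj
          simp
        · simp [hj]
      rw [heq, eval_add_single (hq k), ih, hcon _ hmem k ih]
      simp
  refine eq_zero_of_eventually_eval_eq_zero (z := z₀) ?_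
  filter_upwards [isOpen_UHP_s6.mem_nhds hz₀] with z hz
  simpa using hall z hz Finset.univ

end Scalar

section Compression

variable {d m : ℕ}

/-- The scalar polynomial `v* P v`. -/
def compress (P : Matrix (Fin m) (Fin m) (MvPolynomial (Fin d) ℂ)) (v : Fin m → ℂ) :
    MvPolynomial (Fin d) ℂ :=
  ∑ i, ∑ j, C (star (v i) * v j) * P i j

lemma dotProduct_mulVec_eq_sum_s6 (B : Matrix (Fin m) (Fin m) ℂ) (v : Fin m → ℂ) :
    star v ⬝ᵥ B *ᵥ v = ∑ i, ∑ j, star (v i) * v j * B i j := by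
  simp only [dotProduct, mulVec, Finset.mul_sum, Pi.star_apply]
  exact Finset.sum_congr rfl fun i _ => Finset.sum_congr rfl fun j _ => by ring

lemma eval_compress (P : Matrix (Fin m) (Fin m) (MvPolynomial (Fin d) ℂ)) (v : Fin m → ℂ)
    (z : Fin d → ℂ) :
    eval z (compress P v) = star v ⬝ᵥ (Matrix.of fun i j => eval z (P i j)) *ᵥ v := by
  rw [dotProduct_mulVec_eq_sum_s6]
  simp [compress]

lemma conjPoly_compress {P : Matrix (Fin m) (Fin m) (MvPolynomial (Fin d) ℂ)}
    (hP : ∀ i j, conjPoly (P i j) = P j i) (v : Fin m → ℂ) :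
    conjPoly (compress P v) = compress P v := by
  have hP' : ∀ i j, MvPolynomial.map (starRingEnd ℂ) (P i j) = P j i := hP
  rw [conjPoly, compress]
  simp only [map_sum, map_mul, map_C, hP']
  rw [Finset.sum_comm]
  refine Finset.sum_congr rfl fun i _ => Finset.sum_congr rfl fun j _ => ?_
  simp [mul_comm]

lemma degreeOf_compress_le {P : Matrix (Fin m) (Fin m) (MvPolynomial (Fin d) ℂ)} {k : Fin d}
    {n : ℕ} (hP : ∀ i j, (P i j).degreeOf k ≤ n) (v : Fin m → ℂ) :
    (compress P v).degreeOf k ≤ n :=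
  (degreeOf_sum_le _ _ _).trans <| Finset.sup_le fun i _ =>
    (degreeOf_sum_le _ _ _).trans <| Finset.sup_le fun j _ =>
      (degreeOf_C_mul_le _ _ _).trans (hP i j)

lemma compress_wronskian (q : MvPolynomial (Fin d) ℂ)
    (P : Matrix (Fin m) (Fin m) (MvPolynomial (Fin d) ℂ)) (k : Fin d) (v : Fin m → ℂ) :
    compress (wronskian q P k) v =
      q * pderiv k (compress P v) - compress P v * pderiv k q := by
  simp only [compress, wronskian, Matrix.of_apply, map_sum, pderiv_C_mul, Finset.mul_sum,
    Finset.sum_mul, ← Finset.sum_sub_distrib]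
  refine Finset.sum_congr rfl fun i _ => Finset.sum_congr rfl fun j _ => ?_
  ring

lemma eq_zero_of_dotProduct_mulVec_eq_zero {B : Matrix (Fin m) (Fin m) ℂ}
    (h : ∀ v : Fin m → ℂ, star v ⬝ᵥ B *ᵥ v = 0) : B = 0 := by
  have hT : Matrix.toEuclideanLin B = 0 := by
    refine (inner_map_self_eq_zero _).1 fun x => ?_
    rw [← inner_conj_symm, EuclideanSpace.inner_eq_star_dotProduct, dotProduct_comm]
    simpa using h x.ofLp
  simpa using hT

lemma isHermitian_wronskian_eval {q : MvPolynomial (Fin d) ℂ}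
    {P : Matrix (Fin m) (Fin m) (MvPolynomial (Fin d) ℂ)} (hq : conjPoly q = q)
    (hP : ∀ i j, conjPoly (P i j) = P j i) (k : Fin d) (x : Fin d → ℝ) :
    (Matrix.of fun i j => eval (fun t => (x t : ℂ)) (wronskian q P k i j)).IsHermitian := by
  ext i j
  rw [conjTranspose_apply, of_apply, of_apply, star_eval_ofReal]
  congr 1
  have hq' : MvPolynomial.map (starRingEnd ℂ) q = q := hq
  have hP' : MvPolynomial.map (starRingEnd ℂ) (P j i) = P i j := hP j i
  simp only [conjPoly, wronskian, of_apply, map_sub, map_mul, ← pderiv_map, hq', hP']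

/-- The Hermitian form of `Im (P/q)` in terms of `imForm`. -/
lemma dotProduct_imPart_mulVec_s6 (q : MvPolynomial (Fin d) ℂ)
    (P : Matrix (Fin m) (Fin m) (MvPolynomial (Fin d) ℂ)) (z : Fin d → ℂ) (v : Fin m → ℂ) :
    star v ⬝ᵥ imPart ((eval z q)⁻¹ • Matrix.of fun i j => eval z (P i j)) *ᵥ v =
      (((Complex.normSq (eval z q))⁻¹ * imForm (compress P v) q z : ℝ) : ℂ) := by
  set B : Matrix (Fin m) (Fin m) ℂ := Matrix.of fun i j => eval z (P i j) with hB
  have h1 : ∀ N : Matrix (Fin m) (Fin m) ℂ,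
      star v ⬝ᵥ imPart N *ᵥ v = ((star v ⬝ᵥ N *ᵥ v).im : ℂ) := by
    intro N
    have hN : star v ⬝ᵥ Nᴴ *ᵥ v = star (star v ⬝ᵥ N *ᵥ v) := by
      rw [star_dotProduct, star_mulVec, ← dotProduct_mulVec]
      simp [dotProduct_comm]
    rw [imPart, smul_mulVec, dotProduct_smul, sub_mulVec, dotProduct_sub, hN,
      Complex.star_def, Complex.sub_conj, smul_eq_mul]
    field_simp
    simp
  rw [h1, smul_mulVec, dotProduct_smul, imForm, eval_compress, ← hB]
  congr 1
  simp only [smul_eq_mul, Complex.mul_im, Complex.inv_re, Complex.inv_im, Complex.star_def,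
    Complex.conj_re, Complex.conj_im]
  ring

lemma isHermitian_imPart (N : Matrix (Fin m) (Fin m) ℂ) : (imPart N).IsHermitian := by
  rw [IsHermitian, imPart, conjTranspose_smul, conjTranspose_sub, conjTranspose_conjTranspose]
  rw [← neg_sub N, smul_neg, ← neg_smul]
  congr 1
  simp

lemma posSemidef_imPart_iff (q : MvPolynomial (Fin d) ℂ)
    (P : Matrix (Fin m) (Fin m) (MvPolynomial (Fin d) ℂ)) (z : Fin d → ℂ) :
    (imPart ((eval z q)⁻¹ • Matrix.of fun i j => eval z (P i j))).PosSemidef ↔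
      ∀ v, 0 ≤ imForm (compress P v) q z := by
  constructor
  · intro h v
    by_cases h0 : eval z q = 0
    · simp [imForm, h0]
    · have hv := h.dotProduct_mulVec_nonneg v
      rw [dotProduct_imPart_mulVec_s6, Complex.zero_le_real] at hv
      exact nonneg_of_mul_nonneg_right hv (inv_pos.2 (Complex.normSq_pos.2 h0))
  · intro h
    refine PosSemidef.of_dotProduct_mulVec_nonneg (isHermitian_imPart _) fun v => ?_
    rw [dotProduct_imPart_mulVec_s6, Complex.zero_le_real]
    exact mul_nonneg (inv_nonneg.2 (Complex.normSq_nonneg _)) (h v)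

lemma posSemidef_wronskian_iff {q : MvPolynomial (Fin d) ℂ}
    {P : Matrix (Fin m) (Fin m) (MvPolynomial (Fin d) ℂ)} (hq : conjPoly q = q)
    (hP : ∀ i j, conjPoly (P i j) = P j i) (k : Fin d) (x : Fin d → ℝ) :
    (Matrix.of fun i j => eval (fun t => (x t : ℂ)) (wronskian q P k i j)).PosSemidef ↔
      ∀ v, 0 ≤ (eval (fun t => (x t : ℂ))
        (q * pderiv k (compress P v) - compress P v * pderiv k q)).re := by
  have hH := isHermitian_wronskian_eval hq hP k x
  constructor
  · intro h v
    rw [← compress_wronskian, eval_compress]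
    exact (Complex.le_def.1 (h.dotProduct_mulVec_nonneg v)).1
  · intro h
    refine PosSemidef.of_dotProduct_mulVec_nonneg hH fun v => ?_
    rw [Complex.le_def]
    refine ⟨?_, (hH.im_star_dotProduct_mulVec_self v).symm⟩
    have := h v
    rwa [← compress_wronskian, eval_compress] at this

lemma wronskian_re_nonneg_of_imForm_nonneg {p q : MvPolynomial (Fin d) ℂ} {k : Fin d}
    (hp : p.degreeOf k ≤ 1) (hq : q.degreeOf k ≤ 1)
    (hpr : conjPoly p = p) (hqr : conjPoly q = q)
    (hN : ∀ z ∈ UHP (Fin d), 0 ≤ imForm p q z) (x : Fin d → ℝ) :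
    0 ≤ (eval (fun t => (x t : ℂ)) (q * pderiv k p - p * pderiv k q)).re := by
  set X : Fin d → ℂ := fun t => (x t : ℂ) with hX
  have hlim : 0 ≤ imForm p q (X + Pi.single k Complex.I) := by
    set γ : ℝ → Fin d → ℂ := fun s j =>
      (X + Pi.single k Complex.I : Fin d → ℂ) j + s * Complex.I with hγ
    have hγc : Continuous γ := by
      simp only [hγ]
      fun_prop
    have htend := ((continuous_imForm p q).comp hγc).tendsto 0
    have hγ0 : γ 0 = X + Pi.single k Complex.I := by
      ext j
      simp [hγ]
    rw [Function.comp_apply, hγ0] at htend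
    refine ge_of_tendsto (htend.mono_left (nhdsWithin_le_nhds (s := Set.Ioi 0))) ?_
    filter_upwards [self_mem_nhdsWithin] with s hs
    refine hN _ fun j => ?_
    have hs : 0 < s := hs
    by_cases hj : j = k
    · subst hj
      simp [hγ, hX]
      linarith
    · simp [hγ, hX, hj, hs]
  rw [imForm_add_single hp hq] at hlim
  have i1 := eval_ofReal_im_eq_zero hqr x
  have i2 := eval_ofReal_im_eq_zero hpr x
  have i3 := eval_ofReal_im_eq_zero (conjPoly_pderiv hqr k) x
  have i4 := eval_ofReal_im_eq_zero (conjPoly_pderiv hpr k) x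
  rw [← hX] at i1 i2 i3 i4
  simp [i1, i2, i3, i4] at hlim ⊢
  linarith

lemma dvd_of_forall_dvd_mul {R ι : Type*} [CommRing R] [IsDomain R]
    [UniqueFactorizationMonoid R] {q s : R} {P : ι → R} (hq : q ≠ 0)
    (hcop : ∀ r, (∀ i, r ∣ P i) → r ∣ q → IsUnit r) (h : ∀ i, q ∣ P i * s) : q ∣ s := by
  obtain ⟨q', s', c, hrel, rfl, rfl⟩ := UniqueFactorizationMonoid.exists_reduced_factors q hq s
  have hc : c ≠ 0 := left_ne_zero_of_mul hq
  have hu : IsUnit q' := by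
    refine hcop q' (fun i => ?_) (dvd_mul_left _ _)
    have hi := h i
    rw [mul_left_comm, mul_dvd_mul_iff_left hc] at hi
    exact hrel.dvd_of_dvd_mul_right hi
  exact mul_dvd_mul_left c (hu.dvd)

lemma eval_ne_zero_of_imForm_nonneg {q : MvPolynomial (Fin d) ℂ}
    {P : Matrix (Fin m) (Fin m) (MvPolynomial (Fin d) ℂ)}
    (hcop : ∀ r : MvPolynomial (Fin d) ℂ, (∀ i j, r ∣ P i j) → r ∣ q → IsUnit r)
    (hP : ∀ k i j, (P i j).degreeOf k ≤ 1) (hq : ∀ k, q.degreeOf k ≤ 1) (hne : q ≠ 0)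
    (hN : ∀ v, ∀ z ∈ UHP (Fin d), 0 ≤ imForm (compress P v) q z) :
    ∀ z ∈ UHP (Fin d), eval z q ≠ 0 := by
  intro z₀ hz₀ h0
  obtain ⟨z, hz, k, hzq, hzk⟩ := exists_zero_with_pderiv_ne_zero hq hne hz₀ h0
  have hcw : ∀ v, compress (wronskian q P k) v = 0 := fun v => by
    rw [compress_wronskian]
    exact wronskian_eq_zero_of_imForm_nonneg (degreeOf_compress_le (hP k) v) (hq k) (hN v)
      hz hzq hzk
  have hW : ∀ i j, wronskian q P k i j = 0 := by
    intro i j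
    refine MvPolynomial.funext fun x => ?_
    have hB := eq_zero_of_dotProduct_mulVec_eq_zero
      (B := Matrix.of fun i j => eval x (wronskian q P k i j)) fun v => by
        rw [← eval_compress, hcw, map_zero]
    simpa using congrFun (congrFun hB i) j
  have hdvd : q ∣ pderiv k q := by
    refine dvd_of_forall_dvd_mul (P := fun ij : Fin m × Fin m => P ij.1 ij.2) hne
      (fun r hr => hcop r fun i j => hr (i, j)) fun ij => ?_
    exact ⟨pderiv k (P ij.1 ij.2), (sub_eq_zero.1 (hW ij.1 ij.2)).symm⟩
  obtain ⟨s, hs⟩ := hdvd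
  apply hzk
  rw [hs, map_mul, hzq, zero_mul]

end Compression

/-- a rational multi-affine matrix-valued function `f = P/q` (with the
usual Cayley-inner normalization: real-coefficient `q`, Hermitian coefficients for `P`,
`P` and `q` coprime) belongs to the Cayley inner Pick class `ℐ𝒫_d^{m×m}` if and only
if all partial Wronskians `W_k[q,P]` are PSD matrix-valued polynomials. -/
theorem multiaffine_cayley_inner_iff_wronskians_PSD (d m : ℕ)
    (P : Matrix (Fin m) (Fin m) (MvPolynomial (Fin d) ℂ))
    (q : MvPolynomial (Fin d) ℂ)
    (hcop : ∀ r : MvPolynomial (Fin d) ℂ, (∀ i j, r ∣ P i j) → r ∣ q → IsUnit r)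
    (hq : conjPoly q = q)
    (hP : ∀ i j, conjPoly (P i j) = P j i)
    -- multi-affinity: `max{deg_{z_k} P, deg_{z_k} q} = 1` for every `k`
    (hma : ∀ k : Fin d,
      max (q.degreeOf k)
        (Finset.univ.sup fun ij : Fin m × Fin m => (P ij.1 ij.2).degreeOf k) = 1)
    (f : (Fin d → ℂ) → Matrix (Fin m) (Fin m) ℂ)
    (hfdef : ∀ z, f z = (eval z q)⁻¹ • Matrix.of fun i j => eval z (P i j)) :
    -- `f ∈ ℐ𝒫_d^{m×m}` :
    ((∀ i j, DifferentiableOn ℂ (fun z => f z i j) (UHP (Fin d))) ∧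
     (∀ z ∈ UHP (Fin d), (imPart (f z)).PosSemidef) ∧
     (∀ x : Fin d → ℝ, eval (fun t => (x t : ℂ)) q ≠ 0 →
       (f fun t => (x t : ℂ)).IsHermitian))
    ↔
    (∀ (k : Fin d) (x : Fin d → ℝ),
      (Matrix.of fun i j => eval (fun t => (x t : ℂ)) (wronskian q P k i j)).PosSemidef) := by
  have hq1 : ∀ k, q.degreeOf k ≤ 1 := fun k => (le_max_left _ _).trans (hma k).le
  have hP1 : ∀ k i j, (P i j).degreeOf k ≤ 1 := fun k i j =>
    ((Finset.le_sup (f := fun ij : Fin m × Fin m => (P ij.1 ij.2).degreeOf k)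
      (Finset.mem_univ (i, j))).trans (le_max_right _ _)).trans (hma k).le
  have hpr := conjPoly_compress hP
  have hp1 : ∀ v k, (compress P v).degreeOf k ≤ 1 := fun v k => degreeOf_compress_le (hP1 k) v
  simp only [hfdef, posSemidef_imPart_iff, posSemidef_wronskian_iff hq hP]
  constructor
  · rintro ⟨-, hN, -⟩ k x v
    exact wronskian_re_nonneg_of_imForm_nonneg (hp1 v k) (hq1 k) (hpr v) hq
      (fun z hz => hN z hz v) x
  · intro hW
    have hN : ∀ v, ∀ z ∈ UHP (Fin d), 0 ≤ imForm (compress P v) q z := by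
      intro v z hz
      have h := imForm_nonneg_of_wronskian (hp1 v) hq1 (hpr v) hq (fun k x => hW k x v)
        Finset.univ (fun j => (z j).re) (fun j => (z j).im) (fun j => (hz j).le) (by simp)
      simpa only [Complex.re_add_im] using h
    refine ⟨fun i j => ?_, fun z hz v => hN v z hz, fun x _ => ?_⟩
    · by_cases hne : q = 0
      · simp [hne]
      · have hd : ∀ u : MvPolynomial (Fin d) ℂ, Differentiable ℂ fun x => eval x u := fun u =>
          differentiableOn_univ.1 (AnalyticOnNhd.eval_mvPolynomial u).differentiableOn
        have hq0 := eval_ne_zero_of_imForm_nonneg hcop hP1 hq1 hne hN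
        simp only [Matrix.smul_apply, Matrix.of_apply, smul_eq_mul]
        exact ((hd q).differentiableOn.inv hq0).mul (hd (P i j)).differentiableOn
    · ext i j
      simp only [conjTranspose_apply, Matrix.smul_apply, of_apply, smul_eq_mul, star_mul',
        star_inv₀, star_eval_ofReal, hq, hP]
end
end

section
/- Let F(z) be a ℂ^{m×m}-valued PSD polynomial in d variables (F(x) ⪰ 0 for all x ∈ ℝ^d). Then there exists a scalar polynomial s(z) ∈ ℝ[z₁, …, z_d] and a ℂ^{m×k}-valued polynomial M(z) such that s(z)²·F(z) = M(z)·M(z̄)* identically; that is, s²F is an SOS polynomial. -/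
open Matrix MvPolynomial
open scoped ComplexOrder

noncomputable section

/-- A real polynomial viewed as a complex one. -/
def toℂ {d : ℕ} (s : MvPolynomial (Fin d) ℝ) : MvPolynomial (Fin d) ℂ :=
  MvPolynomial.map (algebraMap ℝ ℂ) s

set_option linter.unusedSectionVars false

open SignType (sign)

section PolynomialIVT

variable {R : Type*} [Field R] [LinearOrder R] [IsStrictOrderedRing R]

/-- The intermediate value property for polynomials over an ordered field. -/
def PolynomialIVT (R : Type*) [Field R] [LinearOrder R] : Prop :=
  ∀ (p : Polynomial R) (a b : R), a < b → p.eval a * p.eval b < 0 →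
    ∃ c, a < c ∧ c < b ∧ p.eval c = 0

theorem PolynomialIVT.sign_eq (hR : PolynomialIVT R) {p : Polynomial R} {a b : R} (hab : a ≤ b)
    (h : ∀ c, a ≤ c → c ≤ b → p.eval c ≠ 0) : sign (p.eval a) = sign (p.eval b) := by
  rcases hab.eq_or_lt with rfl | hab
  · rfl
  by_contra hne
  have ha := h a le_rfl hab.le
  have hb := h b hab.le le_rfl
  have : p.eval a * p.eval b < 0 := by
    rcases ha.lt_or_gt with ha | ha <;> rcases hb.lt_or_gt with hb | hb
    · simp [sign_neg ha, sign_neg hb] at hne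
    · exact mul_neg_of_neg_of_pos ha hb
    · exact mul_neg_of_pos_of_neg ha hb
    · simp [sign_pos ha, sign_pos hb] at hne
  obtain ⟨c, hac, hcb, hc⟩ := hR p a b hab this
  exact h c hac.le hcb.le hc

/-- Rolle's theorem for two consecutive roots. -/
theorem PolynomialIVT.rolle_of_consecutive (hR : PolynomialIVT R) {p : Polynomial R} (hp : p ≠ 0)
    {a b : R} (hab : a < b) (ha : p.eval a = 0) (hb : p.eval b = 0)
    (h : ∀ c, a < c → c < b → p.eval c ≠ 0) :
    ∃ c, a < c ∧ c < b ∧ p.derivative.eval c = 0 := by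
  obtain ⟨q, hq, hqa⟩ := Polynomial.exists_eq_pow_rootMultiplicity_mul_and_not_dvd p hp a
  have hk : 0 < p.rootMultiplicity a := (Polynomial.rootMultiplicity_pos hp).2 ha
  obtain ⟨k, hk⟩ := Nat.exists_eq_succ_of_ne_zero hk.ne'
  have hq0 : q ≠ 0 := by rintro rfl; simp at hqa
  have hba : b - a ≠ 0 := sub_ne_zero.2 hab.ne'
  have hqb : q.eval b = 0 := by
    rw [hq] at hb
    simpa [hba] using hb
  obtain ⟨r, hr, hrb⟩ := Polynomial.exists_eq_pow_rootMultiplicity_mul_and_not_dvd q hq0 b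
  have hl : 0 < q.rootMultiplicity b := (Polynomial.rootMultiplicity_pos hq0).2 hqb
  obtain ⟨l, hl⟩ := Nat.exists_eq_succ_of_ne_zero hl.ne'
  rw [hl] at hr
  rw [hk, hr] at hq
  rw [Polynomial.dvd_iff_isRoot, Polynomial.IsRoot.def] at hqa hrb
  have hra : r.eval a ≠ 0 := fun h0 => hqa (by rw [hr]; simp [h0])
  have hrs : sign (r.eval a) = sign (r.eval b) := hR.sign_eq hab.le fun c hac hcb h0 => by
    rcases hac.eq_or_lt with rfl | hac
    · exact hra h0
    rcases hcb.eq_or_lt with rfl | hcb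
    · exact hrb h0
    exact h c hac hcb (by rw [hq]; simp [h0])
  have hpos : 0 < r.eval a * r.eval b := by
    rcases lt_or_gt_of_ne hra with h0 | h0
    · rw [sign_neg h0, eq_comm, sign_eq_neg_one_iff] at hrs
      exact mul_pos_of_neg_of_neg h0 hrs
    · rw [sign_pos h0, eq_comm, sign_eq_one_iff] at hrs
      exact mul_pos h0 hrs
  let t : Polynomial R := .C ((k : R) + 1) * (.X - .C b) * r + .C ((l : R) + 1) * (.X - .C a) * r
    + (.X - .C a) * (.X - .C b) * r.derivative
  have ht : p.derivative = (.X - .C a) ^ k * (.X - .C b) ^ l * t := by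
    rw [hq]
    simp only [Nat.succ_eq_add_one, Polynomial.derivative_mul, Polynomial.derivative_pow_succ,
      Polynomial.derivative_sub, Polynomial.derivative_X, Polynomial.derivative_C, t]
    simp only [map_add, map_natCast, map_one]
    ring
  obtain ⟨c, hac, hcb, hc⟩ := hR t a b hab (by
    have : t.eval a * t.eval b =
        -((k + 1) * (l + 1) * (b - a) ^ 2 * (r.eval a * r.eval b)) := by
      simp [t]; ring
    rw [this]
    have := sq_pos_of_ne_zero hba
    exact neg_neg_of_pos (by positivity))
  exact ⟨c, hac, hcb, by rw [ht]; simp [hc]⟩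

theorem PolynomialIVT.rolle (hR : PolynomialIVT R) {p : Polynomial R}
    {a b : R} (hab : a < b) (ha : p.eval a = 0) (hb : p.eval b = 0) :
    ∃ c, a < c ∧ c < b ∧ p.derivative.eval c = 0 := by
  rcases eq_or_ne p 0 with rfl | hp
  · obtain ⟨c, hc⟩ := exists_between hab
    exact ⟨c, hc.1, hc.2, by simp⟩
  let s := p.roots.toFinset.filter (a < ·)
  have hs : ∀ c, c ∈ s ↔ p.eval c = 0 ∧ a < c := fun c => by simp [s, hp]
  have hne : s.Nonempty := ⟨b, (hs b).2 ⟨hb, hab⟩⟩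
  have hmin := (hs _).1 (s.min'_mem hne)
  obtain ⟨c, hac, hcb, hc⟩ := hR.rolle_of_consecutive hp hmin.2 ha hmin.1
    fun c hac hc h0 => hc.not_ge (s.min'_le c ((hs c).2 ⟨h0, hac⟩))
  exact ⟨c, hac, hcb.trans_le (s.min'_le b ((hs b).2 ⟨hb, hab⟩)), hc⟩

/-- The mean value theorem. -/
theorem PolynomialIVT.exists_derivative_eq_slope (hR : PolynomialIVT R) (p : Polynomial R)
    {a b : R} (hab : a < b) :
    ∃ c, a < c ∧ c < b ∧ p.eval b - p.eval a = p.derivative.eval c * (b - a) := by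
  obtain ⟨c, hac, hcb, hc⟩ := hR.rolle
    (p := .C (b - a) * (p - .C (p.eval a)) - .C (p.eval b - p.eval a) * (.X - .C a)) hab
    (by simp) (by simp; ring)
  refine ⟨c, hac, hcb, ?_⟩
  simp at hc
  linear_combination -hc

theorem PolynomialIVT.lt_of_derivative_pos (hR : PolynomialIVT R) {p : Polynomial R} {a b : R}
    (hab : a < b) (h : ∀ c, a < c → c < b → 0 < p.derivative.eval c) : p.eval a < p.eval b := by
  obtain ⟨c, hac, hcb, hc⟩ := hR.exists_derivative_eq_slope p hab
  have := mul_pos (h c hac hcb) (sub_pos.2 hab)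
  linarith

/-- A polynomial eventually has the sign of its leading coefficient. -/
theorem exists_forall_ge_sign_eval (p : Polynomial R) :
    ∃ B, ∀ x, B ≤ x → sign (p.eval x) = sign p.leadingCoeff := by
  have hlarge : ∀ p : Polynomial R, 0 < p.degree → 0 < p.leadingCoeff →
      ∀ C, ∃ B, ∀ x, B ≤ x → C ≤ p.eval x := by
    intro p hp
    refine Polynomial.degree_pos_induction_on (P := fun p => 0 < p.leadingCoeff →
      ∀ C, ∃ B, ∀ x, B ≤ x → C ≤ p.eval x) p hp ?_ ?_ ?_
    · intro a ha hl C
      replace hl : 0 < a := by simpa using hl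
      refine ⟨C / a, fun x hx => ?_⟩
      rw [div_le_iff₀ hl] at hx
      rwa [Polynomial.eval_mul, Polynomial.eval_C, Polynomial.eval_X, mul_comm]
    · intro p hp ih hl C
      replace hl : 0 < p.leadingCoeff := by simpa using hl
      obtain ⟨B, hB⟩ := ih hl 1
      refine ⟨max (max B 0) C, fun x hx => ?_⟩
      simp only [max_le_iff] at hx
      have := hB x hx.1.1
      simp only [Polynomial.eval_mul, Polynomial.eval_X]
      nlinarith [mul_nonneg (sub_nonneg.2 this) hx.1.2]
    · intro p a hp ih hl C
      rw [Polynomial.leadingCoeff_add_of_degree_lt'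
        (Polynomial.degree_C_le.trans_lt hp)] at hl
      obtain ⟨B, hB⟩ := ih hl (C - a)
      refine ⟨B, fun x hx => ?_⟩
      have := hB x hx
      simp only [Polynomial.eval_add, Polynomial.eval_C]
      linarith
  rcases le_or_gt p.degree 0 with hd | hd
  · rw [Polynomial.eq_C_of_degree_le_zero hd]
    simp
  have hl : p.leadingCoeff ≠ 0 := fun h => by simp [Polynomial.leadingCoeff_eq_zero.1 h] at hd
  rcases hl.lt_or_gt with hl | hl
  · obtain ⟨B, hB⟩ := hlarge (-p) (by simpa using hd) (by simpa using hl) 1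
    refine ⟨B, fun x hx => ?_⟩
    have := hB x hx
    rw [Polynomial.eval_neg] at this
    rw [sign_neg hl, sign_neg (by linarith)]
  · obtain ⟨B, hB⟩ := hlarge p hd hl 1
    refine ⟨B, fun x hx => ?_⟩
    have := hB x hx
    rw [sign_pos hl, sign_pos (by linarith)]

theorem exists_forall_ge_sign_eval_neg (p : Polynomial R) :
    ∃ B, ∀ x, B ≤ x → sign (p.eval (-x)) = sign ((-1) ^ p.natDegree * p.leadingCoeff) := by
  obtain ⟨B, hB⟩ := exists_forall_ge_sign_eval (p.comp (-.X))
  refine ⟨B, fun x hx => ?_⟩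
  have := hB x hx
  rw [Polynomial.leadingCoeff_comp (by simp)] at this
  simpa [mul_comm] using this

end PolynomialIVT

section SignTransfer

variable {R S : Type*} [Field R] [LinearOrder R] [IsStrictOrderedRing R]
  [Field S] [LinearOrder S] [IsStrictOrderedRing S]

theorem PolynomialIVT.exists_sign_eq_of_derivative_pos
    (hR : PolynomialIVT R) (hS : PolynomialIVT S)
    {p : Polynomial R} {q : Polynomial S} {a x b : R} {a' b' : S} (hax : a < x) (hxb : x < b)
    (hab : a' < b') (hp : ∀ c, a < c → c < b → 0 < p.derivative.eval c)
    (hq : ∀ c, a' < c → c < b' → 0 < q.derivative.eval c)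
    (ha : sign (p.eval a) = sign (q.eval a')) (hb : sign (p.eval b) = sign (q.eval b')) :
    ∃ y, a' < y ∧ y < b' ∧ sign (q.eval y) = sign (p.eval x) := by
  have hpa := hR.lt_of_derivative_pos hax fun c h1 h2 => hp c h1 (h2.trans hxb)
  have hpb := hR.lt_of_derivative_pos hxb fun c h1 h2 => hp c (hax.trans h1) h2
  have hmono : ∀ c d, a' ≤ c → c < d → d ≤ b' → q.eval c < q.eval d := fun c d hc hcd hd =>
    hS.lt_of_derivative_pos hcd fun e h1 h2 => hq e (hc.trans_lt h1) (h2.trans_le hd)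
  rcases lt_trichotomy (p.eval x) 0 with h0 | h0 | h0
  · rw [sign_neg (hpa.trans h0), eq_comm, sign_eq_neg_one_iff] at ha
    rw [sign_neg h0]
    obtain ⟨y, hy1, hy2, hy⟩ : ∃ y, a' < y ∧ y < b' ∧ q.eval y < 0 := by
      rcases le_or_gt (q.eval b') 0 with hb0 | hb0
      · obtain ⟨y, hy1, hy2⟩ := exists_between hab
        exact ⟨y, hy1, hy2, (hmono y b' hy1.le hy2 le_rfl).trans_le hb0⟩
      · obtain ⟨r, hr1, hr2, hr⟩ := hS q a' b' hab (mul_neg_of_neg_of_pos ha hb0)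
        obtain ⟨y, hy1, hy2⟩ := exists_between hr1
        exact ⟨y, hy1, hy2.trans hr2, hr ▸ hmono y r hy1.le hy2 hr2.le⟩
    exact ⟨y, hy1, hy2, sign_neg hy⟩
  · rw [h0] at hpa hpb ⊢
    rw [sign_neg hpa, eq_comm, sign_eq_neg_one_iff] at ha
    rw [sign_pos hpb, eq_comm, sign_eq_one_iff] at hb
    obtain ⟨y, hy1, hy2, hy⟩ := hS q a' b' hab (mul_neg_of_neg_of_pos ha hb)
    exact ⟨y, hy1, hy2, by simp [hy]⟩
  · rw [sign_pos (h0.trans hpb), eq_comm, sign_eq_one_iff] at hb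
    rw [sign_pos h0]
    obtain ⟨y, hy1, hy2, hy⟩ : ∃ y, a' < y ∧ y < b' ∧ 0 < q.eval y := by
      rcases le_or_gt 0 (q.eval a') with ha0 | ha0
      · obtain ⟨y, hy1, hy2⟩ := exists_between hab
        exact ⟨y, hy1, hy2, ha0.trans_lt (hmono a' y le_rfl hy1 hy2.le)⟩
      · obtain ⟨r, hr1, hr2, hr⟩ := hS q a' b' hab (mul_neg_of_neg_of_pos ha0 hb)
        obtain ⟨y, hy1, hy2⟩ := exists_between hr2
        exact ⟨y, hr1.trans hy1, hy2, hr ▸ hmono r y hr1.le hy1 hy2.le⟩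
    exact ⟨y, hy1, hy2, sign_pos hy⟩

theorem PolynomialIVT.exists_sign_eq
    (hR : PolynomialIVT R) (hS : PolynomialIVT S)
    {p : Polynomial R} {q : Polynomial S} {a x b : R} {a' b' : S} (hax : a < x) (hxb : x < b)
    (hab : a' < b') {ε : SignType} (hε : ε ≠ 0)
    (hp : ∀ c, a < c → c < b → sign (p.derivative.eval c) = ε)
    (hq : ∀ c, a' < c → c < b' → sign (q.derivative.eval c) = ε)
    (ha : sign (p.eval a) = sign (q.eval a')) (hb : sign (p.eval b) = sign (q.eval b')) :
    ∃ y, a' < y ∧ y < b' ∧ sign (q.eval y) = sign (p.eval x) := by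
  cases ε with
  | zero => exact absurd rfl hε
  | neg =>
    obtain ⟨y, h1, h2, h3⟩ := hR.exists_sign_eq_of_derivative_pos hS (p := -p) (q := -q)
      hax hxb hab
      (fun c h1 h2 => by simpa using sign_eq_neg_one_iff.1 (hp c h1 h2))
      (fun c h1 h2 => by simpa using sign_eq_neg_one_iff.1 (hq c h1 h2))
      (by simp [Left.sign_neg, ha]) (by simp [Left.sign_neg, hb])
    exact ⟨y, h1, h2, by simpa [Left.sign_neg] using h3⟩
  | pos =>
    exact hR.exists_sign_eq_of_derivative_pos hS hax hxb hab
      (fun c h1 h2 => sign_eq_one_iff.1 (hp c h1 h2))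
      (fun c h1 h2 => sign_eq_one_iff.1 (hq c h1 h2)) ha hb

variable {A : Type*} [CommRing A]

/-- Every finite configuration of points of `R` can be copied to `S`, preserving the order and
the signs of the polynomials in `L`. -/
def SignSim (L : Set (Polynomial A)) (φ : A →+* R) (ψ : A →+* S) : Prop :=
  ∀ T : Finset R, ∃ f : R → S, StrictMonoOn f T ∧
    ∀ x ∈ T, ∀ p ∈ L, sign (p.eval₂ φ x) = sign (p.eval₂ ψ (f x))

theorem SignSim.mono {L L' : Set (Polynomial A)} {φ : A →+* R} {ψ : A →+* S}
    (h : SignSim L' φ ψ) (hL : L ⊆ L') : SignSim L φ ψ := fun T => by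
  obtain ⟨f, hf, hs⟩ := h T
  exact ⟨f, hf, fun x hx p hp => hs x hx p (hL hp)⟩

theorem eval₂_eq_zero_iff_of_sign_eq {p : Polynomial A} {φ : A →+* R} {ψ : A →+* S} {x : R} {y : S}
    (h : sign (p.eval₂ φ x) = sign (p.eval₂ ψ y)) : p.eval₂ φ x = 0 ↔ p.eval₂ ψ y = 0 := by
  rw [← sign_eq_zero_iff, h, sign_eq_zero_iff]

theorem SignSim.map_ne_zero {L : Set (Polynomial A)} {φ : A →+* R} {ψ : A →+* S}
    (h : SignSim L φ ψ) {p : Polynomial A} (hp : p ∈ L) (hφ : p.map φ ≠ 0) : p.map ψ ≠ 0 := by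
  obtain ⟨x, hx⟩ : ∃ x, (p.map φ).eval x ≠ 0 := by
    by_contra! hx
    exact hφ (Polynomial.funext (by simpa using hx))
  obtain ⟨f, -, hs⟩ := h {x}
  have := hs x (by simp) p hp
  rw [Polynomial.eval_map] at hx
  intro h0
  exact hx ((eval₂_eq_zero_iff_of_sign_eq this).2 (by rw [Polynomial.eval₂_eq_eval_map, h0]; simp))

/-- The roots of the nonzero specialisations of the polynomials in `L`. -/
def rootFinset (L : Finset (Polynomial A)) (φ : A →+* R) : Finset R :=
  L.biUnion fun p => (p.map φ).roots.toFinset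

theorem mem_rootFinset {L : Finset (Polynomial A)} {φ : A →+* R} {x : R} :
    x ∈ rootFinset L φ ↔ ∃ p ∈ L, p.map φ ≠ 0 ∧ p.eval₂ φ x = 0 := by
  simp [rootFinset, Polynomial.eval_map]

theorem sign_eq_of_forall_notMem_rootFinset (hR : PolynomialIVT R) {L : Finset (Polynomial A)}
    {φ : A →+* R} {a b : R} (h : ∀ z ∈ rootFinset L φ, (z < a ∧ z < b) ∨ (a < z ∧ b < z))
    {p : Polynomial A} (hp : p ∈ L) : sign (p.eval₂ φ a) = sign (p.eval₂ φ b) := by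
  by_cases h0 : p.map φ = 0
  · simp [Polynomial.eval₂_eq_eval_map, h0]
  wlog hab : a ≤ b generalizing a b
  · exact (this (fun z hz => by simpa [and_comm] using h z hz) (le_of_not_ge hab)).symm
  rw [Polynomial.eval₂_eq_eval_map, Polynomial.eval₂_eq_eval_map]
  refine hR.sign_eq hab fun c hac hcb hc => ?_
  rw [Polynomial.eval_map] at hc
  rcases h c (mem_rootFinset.2 ⟨p, hp, h0, hc⟩) with h | h
  · exact h.1.not_ge hac
  · exact h.2.not_ge hcb

theorem SignSim.card_rootFinset_le {L : Finset (Polynomial A)} {φ : A →+* R} {ψ : A →+* S}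
    (h : SignSim (L : Set (Polynomial A)) φ ψ) :
    (rootFinset L φ).card ≤ (rootFinset L ψ).card := by
  obtain ⟨f, hf, hs⟩ := h (rootFinset L φ)
  refine Finset.card_le_card_of_injOn f (fun x hx => ?_) hf.injOn
  obtain ⟨p, hp, hp0, hpx⟩ := mem_rootFinset.1 hx
  exact mem_rootFinset.2 ⟨p, hp, h.map_ne_zero hp hp0,
    (eval₂_eq_zero_iff_of_sign_eq (hs x hx p hp)).1 hpx⟩

end SignTransfer

section SignTransferInsert

variable {R S : Type*} [Field R] [LinearOrder R] [IsStrictOrderedRing R]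
  [Field S] [LinearOrder S] [IsStrictOrderedRing S] {A : Type*} [CommRing A]

/-- A copying map for `L` and the signs of `p` on a finite set `D` of points extends to one more
point. -/
theorem exists_extend_point (hR : PolynomialIVT R) (hS : PolynomialIVT S)
    {L : Finset (Polynomial A)} {p : Polynomial A} {φ : A →+* R} {ψ : A →+* S}
    (hL : Polynomial.derivative p ∈ L) (hp : (Polynomial.derivative p).map φ ≠ 0)
    {D : Finset R} (hZ : rootFinset L φ ⊆ D) {h : R → S} (hmono : StrictMonoOn h D)
    (hsurj : ∀ w ∈ rootFinset L ψ, ∃ z ∈ rootFinset L φ, h z = w)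
    (hsign : ∀ z ∈ D, sign (p.eval₂ φ z) = sign (p.eval₂ ψ (h z)))
    {x : R} {y₀ : S} (hx : x ∉ D) (hlo : ∃ z ∈ D, z < x) (hhi : ∃ z ∈ D, x < z)
    (hy₀ : ∀ z ∈ rootFinset L φ, (z < x → h z < y₀) ∧ (x < z → y₀ < h z))
    (hxy : ∀ g ∈ L, sign (g.eval₂ φ x) = sign (g.eval₂ ψ y₀)) :
    ∃ y, (∀ z ∈ D, z < x → h z < y) ∧ (∀ z ∈ D, x < z → y < h z) ∧
      sign (p.eval₂ φ x) = sign (p.eval₂ ψ y) := by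
  have hne : (D.filter (· < x)).Nonempty := by
    obtain ⟨z, hz⟩ := hlo
    exact ⟨z, by simpa using hz⟩
  have hne' : (D.filter (x < ·)).Nonempty := by
    obtain ⟨z, hz⟩ := hhi
    exact ⟨z, by simpa using hz⟩
  obtain ⟨haD, hax⟩ := Finset.mem_filter.1 (Finset.max'_mem _ hne)
  obtain ⟨hbD, hxb⟩ := Finset.mem_filter.1 (Finset.min'_mem _ hne')
  have hamax : ∀ z ∈ D, z < x → z ≤ (D.filter (· < x)).max' hne := fun z hz hzx =>
    Finset.le_max' _ z (by simpa using ⟨hz, hzx⟩)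
  have hbmin : ∀ z ∈ D, x < z → (D.filter (x < ·)).min' hne' ≤ z := fun z hz hzx =>
    Finset.min'_le _ z (by simpa using ⟨hz, hzx⟩)
  generalize (D.filter (· < x)).max' hne = a at *
  generalize (D.filter (x < ·)).min' hne' = b at *
  have hab : h a < h b := hmono haD hbD (hax.trans hxb)
  have hxne : ∀ z ∈ D, z < x ∨ x < z := fun z hz =>
    lt_or_gt_of_ne fun h => hx (h ▸ hz)
  have hε : sign ((Polynomial.derivative p).eval₂ φ x) ≠ 0 := by
    rw [Ne, sign_eq_zero_iff]
    intro h0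
    exact hx (hZ (mem_rootFinset.2 ⟨_, hL, hp, h0⟩))
  obtain ⟨y, hy1, hy2, hy⟩ := hR.exists_sign_eq hS (p := p.map φ) (q := p.map ψ) hax hxb hab hε
    (fun c h1 h2 => by
      rw [Polynomial.derivative_map, Polynomial.eval_map]
      refine sign_eq_of_forall_notMem_rootFinset hR (fun z hz => ?_) hL
      rcases hxne z (hZ hz) with hzx | hzx
      · exact .inl ⟨(hamax z (hZ hz) hzx).trans_lt h1, hzx⟩
      · exact .inr ⟨h2.trans_le (hbmin z (hZ hz) hzx), hzx⟩)
    (fun c h1 h2 => by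
      rw [Polynomial.derivative_map, Polynomial.eval_map, hxy _ hL]
      refine sign_eq_of_forall_notMem_rootFinset hS (fun w hw => ?_) hL
      obtain ⟨z, hz, rfl⟩ := hsurj w hw
      rcases hxne z (hZ hz) with hzx | hzx
      · exact .inl ⟨(hmono.monotoneOn (hZ hz) haD (hamax z (hZ hz) hzx)).trans_lt h1,
          (hy₀ z hz).1 hzx⟩
      · exact .inr ⟨h2.trans_le (hmono.monotoneOn hbD (hZ hz) (hbmin z (hZ hz) hzx)),
          (hy₀ z hz).2 hzx⟩)
    (by simpa [Polynomial.eval_map] using hsign a haD)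
    (by simpa [Polynomial.eval_map] using hsign b hbD)
  refine ⟨y, fun z hz hzx => ?_, fun z hz hzx => ?_, ?_⟩
  · exact (hmono.monotoneOn hz haD (hamax z hz hzx)).trans_lt hy1
  · exact hy2.trans_le (hmono.monotoneOn hbD hz (hbmin z hz hzx))
  · simpa [Polynomial.eval_map] using hy.symm

theorem strictMonoOn_update_insert {D : Finset R} {h : R → S} (hmono : StrictMonoOn h D)
    {x : R} {y : S} (hx : x ∉ D) (h1 : ∀ z ∈ D, z < x → h z < y) (h2 : ∀ z ∈ D, x < z → y < h z) :
    StrictMonoOn (Function.update h x y) (insert x D : Finset R) := by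
  have hne : ∀ z ∈ D, z ≠ x := fun z hz h => hx (h ▸ hz)
  intro u hu v hv huv
  rw [Finset.mem_coe, Finset.mem_insert] at hu hv
  rcases hu with rfl | hu <;> rcases hv with rfl | hv
  · exact absurd huv (lt_irrefl _)
  · simpa [hne v hv] using h2 v hv huv
  · simpa [hne u hu] using h1 u hu huv
  · simpa [hne u hu, hne v hv] using hmono hu hv huv

/-- A copying map defined on the roots of `L` and on two points enclosing the finite set `T`
extends to `T`. -/
theorem exists_extend_finset (hR : PolynomialIVT R) (hS : PolynomialIVT S)
    {L : Finset (Polynomial A)} {p : Polynomial A} {φ : A →+* R} {ψ : A →+* S}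
    (hL : Polynomial.derivative p ∈ L) (hp : (Polynomial.derivative p).map φ ≠ 0)
    {D : Finset R} (hZ : rootFinset L φ ⊆ D) {h : R → S} (hmono : StrictMonoOn h D)
    (hsurj : ∀ w ∈ rootFinset L ψ, ∃ z ∈ rootFinset L φ, h z = w)
    (hsign : ∀ z ∈ D, sign (p.eval₂ φ z) = sign (p.eval₂ ψ (h z)))
    (T : Finset R) (f : R → S)
    (hlo : ∀ x ∈ T, ∃ z ∈ D, z < x) (hhi : ∀ x ∈ T, ∃ z ∈ D, x < z)
    (hf : ∀ x ∈ T, ∀ z ∈ rootFinset L φ, (z < x → h z < f x) ∧ (x < z → f x < h z))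
    (hfs : ∀ x ∈ T, ∀ g ∈ L, sign (g.eval₂ φ x) = sign (g.eval₂ ψ (f x))) :
    ∃ h' : R → S, StrictMonoOn h' (D ∪ T : Finset R) ∧ (∀ z ∈ D, h' z = h z) ∧
      ∀ z ∈ D ∪ T, sign (p.eval₂ φ z) = sign (p.eval₂ ψ (h' z)) := by
  induction T using Finset.induction_on with
  | empty => exact ⟨h, by simpa using hmono, fun _ _ => rfl, by simpa using hsign⟩
  | insert x T hxT ih =>
    obtain ⟨k, hk, hkD, hks⟩ := ih (fun x hx => hlo x (Finset.mem_insert_of_mem hx))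
      (fun x hx => hhi x (Finset.mem_insert_of_mem hx))
      (fun x hx => hf x (Finset.mem_insert_of_mem hx))
      (fun x hx => hfs x (Finset.mem_insert_of_mem hx))
    rw [Finset.union_insert]
    by_cases hx : x ∈ D ∪ T
    · rw [Finset.insert_eq_of_mem hx]
      exact ⟨k, hk, hkD, hks⟩
    have hDT : ∀ {z}, z ∈ D → z ∈ D ∪ T := fun hz => Finset.mem_union_left _ hz
    have hT := Finset.mem_insert_self x T
    obtain ⟨y, hy1, hy2, hy⟩ := exists_extend_point hR hS hL hp
      (fun z hz => hDT (hZ hz)) hk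
      (fun w hw => by
        obtain ⟨z, hz, rfl⟩ := hsurj w hw
        exact ⟨z, hz, hkD z (hZ hz)⟩) hks hx
      (by obtain ⟨z, hz, h1⟩ := hlo x hT
          exact ⟨z, hDT hz, h1⟩)
      (by obtain ⟨z, hz, h1⟩ := hhi x hT
          exact ⟨z, hDT hz, h1⟩)
      (fun z hz => by rw [hkD z (hZ hz)]; exact hf x hT z hz) (hfs x hT)
    have hne : ∀ z ∈ D ∪ T, z ≠ x := fun z hz h => hx (h ▸ hz)
    refine ⟨Function.update k x y, strictMonoOn_update_insert hk hx hy1 hy2, fun z hz => ?_,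
      fun z hz => ?_⟩
    · rw [Function.update_of_ne (hne z (hDT hz)), hkD z hz]
    · rcases Finset.mem_insert.1 hz with rfl | hz
      · simpa using hy
      · rw [Function.update_of_ne (hne z hz), hks z hz]

theorem exists_abs_lt_forall_sign_eval₂ (p : Polynomial A) (φ : A →+* R)
    (hp : φ p.leadingCoeff ≠ 0) (T : Finset R) :
    ∃ M : R, 0 < M ∧ (∀ x ∈ T, -M < x ∧ x < M) ∧
      sign (p.eval₂ φ M) = sign (φ p.leadingCoeff) ∧
      sign (p.eval₂ φ (-M)) = sign ((-1) ^ p.natDegree * φ p.leadingCoeff) := by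
  obtain ⟨B, hB⟩ := exists_forall_ge_sign_eval (p.map φ)
  obtain ⟨B', hB'⟩ := exists_forall_ge_sign_eval_neg (p.map φ)
  obtain ⟨M, hM⟩ := (T.image abs ∪ {0, B, B'}).exists_le
  have h0 := hM 0 (by simp)
  have h1 := hM B (by simp)
  have h2 := hM B' (by simp)
  refine ⟨M + 1, by linarith, fun x hx => ?_, ?_, ?_⟩
  · have := hM |x| (Finset.mem_union_left _ (Finset.mem_image_of_mem _ hx))
    rw [← abs_lt]
    linarith
  · have := hB (M + 1) (by linarith)
    rwa [Polynomial.eval_map, Polynomial.leadingCoeff_map_of_leadingCoeff_ne_zero φ hp] at this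
  · have := hB' (M + 1) (by linarith)
    rwa [Polynomial.eval_map, Polynomial.leadingCoeff_map_of_leadingCoeff_ne_zero φ hp,
      Polynomial.natDegree_map_of_leadingCoeff_ne_zero φ hp] at this

theorem SignSim.adjoin (hR : PolynomialIVT R) (hS : PolynomialIVT S)
    {L L' : Finset (Polynomial A)} {p : Polynomial A} {φ : A →+* R} {ψ : A →+* S}
    (hL : Polynomial.derivative p ∈ L) (hdeg : p.natDegree ≠ 0)
    (hlead : sign (φ p.leadingCoeff) = sign (ψ p.leadingCoeff)) (hlead0 : φ p.leadingCoeff ≠ 0)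
    (hLL' : L ⊆ L')
    (hrem : ∀ g ∈ L, ∃ r ∈ L',
      (g.map φ ≠ 0 → ∀ z, g.eval₂ φ z = 0 → sign (p.eval₂ φ z) = sign (r.eval₂ φ z)) ∧
      (g.map ψ ≠ 0 → ∀ z, g.eval₂ ψ z = 0 → sign (p.eval₂ ψ z) = sign (r.eval₂ ψ z)))
    (h : SignSim (L' : Set (Polynomial A)) φ ψ) (h' : SignSim (L' : Set (Polynomial A)) ψ φ) :
    SignSim (insert p L : Set (Polynomial A)) φ ψ := by
  have hsub : (L : Set (Polynomial A)) ⊆ L' := by exact_mod_cast hLL'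
  have hcard := le_antisymm (h.mono hsub).card_rootFinset_le (h'.mono hsub).card_rootFinset_le
  have hd0 : (Polynomial.derivative p).map φ ≠ 0 := by
    rw [← Polynomial.derivative_map]
    intro h0
    rw [← Polynomial.natDegree_map_of_leadingCoeff_ne_zero φ hlead0] at hdeg
    exact hdeg (Polynomial.derivative_eq_zero.1 h0)
  have hlead0' : ψ p.leadingCoeff ≠ 0 := by
    rwa [← sign_ne_zero, ← hlead, sign_ne_zero]
  intro T
  obtain ⟨f, hf, hs⟩ := h (T ∪ rootFinset L φ)
  set Z := rootFinset L φ with hZdef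
  have hsL : ∀ x ∈ T ∪ Z, ∀ g ∈ L, sign (g.eval₂ φ x) = sign (g.eval₂ ψ (f x)) :=
    fun x hx g hg => hs x hx g (hLL' hg)
  have hZT : ∀ {z}, z ∈ Z → z ∈ T ∪ Z := fun hz => Finset.mem_union_right _ hz
  have himage : Z.image f = rootFinset L ψ := by
    refine Finset.eq_of_subset_of_card_le (fun w hw => ?_) ?_
    · obtain ⟨z, hz, rfl⟩ := Finset.mem_image.1 hw
      obtain ⟨g, hg, hg0, hgz⟩ := mem_rootFinset.1 hz
      exact mem_rootFinset.2 ⟨g, hg, h.map_ne_zero (hsub hg) hg0,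
        (eval₂_eq_zero_iff_of_sign_eq (hsL z (hZT hz) g hg)).1 hgz⟩
    · rw [Finset.card_image_of_injOn (hf.injOn.mono fun z hz => hZT hz), hcard]
  have hZsign : ∀ z ∈ Z, sign (p.eval₂ φ z) = sign (p.eval₂ ψ (f z)) := fun z hz => by
    obtain ⟨g, hg, hg0, hgz⟩ := mem_rootFinset.1 hz
    obtain ⟨r, hr, hr1, hr2⟩ := hrem g hg
    rw [hr1 hg0 z hgz, hr2 (h.map_ne_zero (hsub hg) hg0) _
      ((eval₂_eq_zero_iff_of_sign_eq (hsL z (hZT hz) g hg)).1 hgz), hs z (hZT hz) r hr]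
  obtain ⟨M, hM0, hM, hM1, hM2⟩ := exists_abs_lt_forall_sign_eval₂ p φ hlead0 (T ∪ Z)
  obtain ⟨N, hN0, hN, hN1, hN2⟩ := exists_abs_lt_forall_sign_eval₂ p ψ hlead0' (Z.image f)
  have hfZ : StrictMonoOn f (Z : Finset R) := hf.mono fun z hz => hZT hz
  have hnM : -M < M := by linarith
  have hMZ : M ∉ Z := fun hz => (hM M (hZT hz)).2.false
  have hmZ : -M ∉ insert M Z := fun hz => by
    rcases Finset.mem_insert.1 hz with hz | hz
    · exact hnM.ne hz
    · exact (hM _ (hZT hz)).1.false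
  have hN' : ∀ z ∈ Z, -N < f z ∧ f z < N := fun z hz => hN _ (Finset.mem_image_of_mem f hz)
  have hZM : ∀ z ∈ Z, z ≠ M := fun z hz h => hMZ (h ▸ hz)
  have hZm : ∀ z ∈ insert M Z, z ≠ -M := fun z hz h => hmZ (h ▸ hz)
  let k := Function.update (Function.update f M N) (-M) (-N)
  have hkM : k M = N := by simp [k, hnM.ne']
  have hkm : k (-M) = -N := by simp [k]
  have hkZ : ∀ z ∈ Z, k z = f z := fun z hz => by
    simp [k, hZM z hz, hZm z (Finset.mem_insert_of_mem hz)]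
  have hk : StrictMonoOn k (insert (-M) (insert M Z) : Finset R) := by
    refine strictMonoOn_update_insert (strictMonoOn_update_insert hfZ hMZ
      (fun z hz _ => (hN' z hz).2) fun z hz hlt => ?_) hmZ (fun z hz hlt => ?_) fun z hz hlt => ?_
    · exact absurd (hM z (hZT hz)).2 hlt.not_gt
    · rcases Finset.mem_insert.1 hz with rfl | hz
      · exact absurd hnM hlt.not_gt
      · exact absurd (hM z (hZT hz)).1 hlt.not_gt
    · rcases Finset.mem_insert.1 hz with rfl | hz
      · simp; linarith
      · simpa [hZM z hz] using (hN' z hz).1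
  obtain ⟨q, hq, hqk, hqs⟩ := exists_extend_finset hR hS hL hd0
    (fun z hz => Finset.mem_insert_of_mem (Finset.mem_insert_of_mem hz)) hk
    (fun w hw => by
      rw [← himage] at hw
      obtain ⟨z, hz, rfl⟩ := Finset.mem_image.1 hw
      exact ⟨z, hz, hkZ z hz⟩)
    (fun z hz => by
      rcases Finset.mem_insert.1 hz with rfl | hz
      · rw [hkm, hM2, hN2]
        simp only [sign_mul, hlead]
        rcases p.natDegree.even_or_odd with h2 | h2 <;> simp [h2.neg_one_pow]
      rcases Finset.mem_insert.1 hz with rfl | hz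
      · rw [hkM, hM1, hN1, hlead]
      · rw [hkZ z hz, hZsign z hz])
    T f (fun x hx => ⟨-M, by simp, (hM x (Finset.mem_union_left _ hx)).1⟩)
    (fun x hx => ⟨M, by simp, (hM x (Finset.mem_union_left _ hx)).2⟩)
    (fun x hx z hz => by
      rw [hkZ z hz]
      exact ⟨fun hlt => hf (hZT hz) (Finset.mem_union_left _ hx) hlt,
        fun hlt => hf (Finset.mem_union_left _ hx) (hZT hz) hlt⟩)
    (fun x hx => hsL x (Finset.mem_union_left _ hx))
  have hqZ : ∀ z ∈ Z, q z = f z := fun z hz => by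
    rw [hqk z (Finset.mem_insert_of_mem (Finset.mem_insert_of_mem hz)), hkZ z hz]
  refine ⟨q, hq.mono fun x hx => Finset.mem_union_right _ hx, fun x hx g hg => ?_⟩
  rcases hg with rfl | hg
  · exact hqs x (Finset.mem_union_right _ hx)
  by_cases hxZ : x ∈ Z
  · rw [hqZ x hxZ, hsL x (hZT hxZ) g hg]
  rw [hsL x (Finset.mem_union_left _ hx) g hg]
  refine sign_eq_of_forall_notMem_rootFinset hS (fun w hw => ?_) hg
  rw [← himage] at hw
  obtain ⟨z, hz, rfl⟩ := Finset.mem_image.1 hw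
  have hzU : z ∈ insert (-M) (insert M Z) ∪ T := by simp [hz]
  have hxU : x ∈ insert (-M) (insert M Z) ∪ T := by simp [hx]
  have hxTZ : x ∈ T ∪ Z := Finset.mem_union_left _ hx
  rcases lt_or_gt_of_ne (fun h => hxZ (h ▸ hz) : z ≠ x) with hlt | hlt
  · exact .inl ⟨hf (hZT hz) hxTZ hlt, hqZ z hz ▸ hq hzU hxU hlt⟩
  · exact .inr ⟨hf hxTZ (hZT hz) hlt, hqZ z hz ▸ hq hxU hzU hlt⟩

end SignTransferInsert

section SignElimination

variable {R S : Type*} [Field R] [LinearOrder R] [IsStrictOrderedRing R]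
  [Field S] [LinearOrder S] [IsStrictOrderedRing S] {A : Type*} [CommRing A]

theorem SignSim.congr {L L' : Set (Polynomial A)} {φ : A →+* R} {ψ : A →+* S}
    (h : SignSim L' φ ψ) (hL : ∀ p ∈ L, ∃ q ∈ L', (∀ x, p.eval₂ φ x = q.eval₂ φ x) ∧
      ∀ x, p.eval₂ ψ x = q.eval₂ ψ x) : SignSim L φ ψ := fun T => by
  obtain ⟨f, hf, hs⟩ := h T
  refine ⟨f, hf, fun x hx p hp => ?_⟩
  obtain ⟨q, hq, h1, h2⟩ := hL p hp
  rw [h1, h2, hs x hx q hq]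

theorem signSim_of_forall_natDegree_eq_zero {L : Set (Polynomial A)} {φ : A →+* R} {ψ : A →+* S}
    (hL : ∀ p ∈ L, p.natDegree = 0)
    (h : ∀ p ∈ L, sign (φ p.leadingCoeff) = sign (ψ p.leadingCoeff)) : SignSim L φ ψ := fun T => by
  refine ⟨fun x => ((T.filter (· < x)).card : S), fun x hx y hy hxy => ?_, fun x hx p hp => ?_⟩
  · refine Nat.cast_lt.2 (Finset.card_lt_card ⟨fun z hz => ?_, fun hsub => ?_⟩)
    · simp only [Finset.mem_filter] at hz ⊢
      exact ⟨hz.1, hz.2.trans hxy⟩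
    · exact (Finset.mem_filter.1 (hsub (Finset.mem_filter.2 ⟨hx, hxy⟩))).2.false
  · have := h p hp
    rw [Polynomial.leadingCoeff, hL p hp] at this
    rw [Polynomial.eq_C_of_natDegree_eq_zero (hL p hp)]
    simpa using this

theorem eval₂_eraseLead_of_map_eq_zero {p : Polynomial A} {φ : A →+* R}
    (hp : φ p.leadingCoeff = 0) (x : R) : p.eval₂ φ x = p.eraseLead.eval₂ φ x := by
  have := congrArg (Polynomial.eval₂ φ x) p.eraseLead_add_C_mul_X_pow
  rw [Polynomial.eval₂_add, Polynomial.eval₂_mul, Polynomial.eval₂_C, hp, zero_mul, add_zero] at this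
  exact this.symm

theorem natDegree_lt_of_coeff_eq_zero {p : Polynomial A} {n : ℕ} (hn : n ≠ 0)
    (hp : p.natDegree ≤ n) (h : p.coeff n = 0) : p.natDegree < n := by
  refine hp.lt_of_ne fun heq => hn ?_
  rw [← heq, Polynomial.coeff_natDegree, Polynomial.leadingCoeff_eq_zero] at h
  rw [← heq, h, Polynomial.natDegree_zero]

/-- One step of pseudo-division of `p` by `g`. -/
def pseudoRem (p g : Polynomial A) : Polynomial A :=
  .C (g.leadingCoeff ^ 2) * p -
    .C (g.leadingCoeff * p.leadingCoeff) * g * .X ^ (p.natDegree - g.natDegree)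

theorem natDegree_pseudoRem_lt {p g : Polynomial A} (hp : p.natDegree ≠ 0)
    (hg : g.natDegree ≤ p.natDegree) : (pseudoRem p g).natDegree < p.natDegree := by
  refine natDegree_lt_of_coeff_eq_zero hp ?_ ?_
  · refine (Polynomial.natDegree_sub_le _ _).trans (max_le (Polynomial.natDegree_C_mul_le _ _) ?_)
    refine Polynomial.natDegree_mul_le.trans ?_
    have h1 := Polynomial.natDegree_C_mul_le (g.leadingCoeff * p.leadingCoeff) g
    have h2 := Polynomial.natDegree_X_pow_le (R := A) (p.natDegree - g.natDegree)
    omega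
  · rw [pseudoRem, Polynomial.coeff_sub, Polynomial.coeff_C_mul, Polynomial.coeff_mul_X_pow',
      if_pos (Nat.sub_le _ _), Nat.sub_sub_self hg, Polynomial.coeff_C_mul,
      Polynomial.coeff_natDegree, Polynomial.coeff_natDegree]
    ring

theorem sign_eval₂_pseudoRem {p g : Polynomial A} {φ : A →+* R} (hg : φ g.leadingCoeff ≠ 0) {z : R}
    (hz : g.eval₂ φ z = 0) : sign (p.eval₂ φ z) = sign ((pseudoRem p g).eval₂ φ z) := by
  have : (pseudoRem p g).eval₂ φ z = φ g.leadingCoeff ^ 2 * p.eval₂ φ z := by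
    rw [pseudoRem, Polynomial.eval₂_sub, Polynomial.eval₂_mul, Polynomial.eval₂_mul,
      Polynomial.eval₂_mul, Polynomial.eval₂_C, hz, map_pow]
    ring
  rw [this, sign_mul, sign_pos (sq_pos_of_ne_zero hg), one_mul]

/-- One step of pseudo-division of `p` by its derivative. -/
def derivRem (p : Polynomial A) : Polynomial A :=
  .C (p.natDegree : A) * p - Polynomial.derivative p * .X

theorem natDegree_derivRem_lt {p : Polynomial A} (hp : p.natDegree ≠ 0) :
    (derivRem p).natDegree < p.natDegree := by
  refine natDegree_lt_of_coeff_eq_zero hp ?_ ?_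
  · refine (Polynomial.natDegree_sub_le _ _).trans (max_le (Polynomial.natDegree_C_mul_le _ _) ?_)
    refine Polynomial.natDegree_mul_le.trans ?_
    have h1 := Polynomial.natDegree_derivative_lt hp
    have h2 := Polynomial.natDegree_X_le (R := A)
    omega
  · obtain ⟨n, hn⟩ := Nat.exists_eq_succ_of_ne_zero hp
    rw [derivRem, hn, Polynomial.coeff_sub, Polynomial.coeff_C_mul, Nat.succ_eq_add_one,
      Polynomial.coeff_mul_X, Polynomial.coeff_derivative]
    push_cast
    ring

theorem sign_eval₂_derivRem {p : Polynomial A} {φ : A →+* R} (hp : p.natDegree ≠ 0) {z : R}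
    (hz : (Polynomial.derivative p).eval₂ φ z = 0) :
    sign (p.eval₂ φ z) = sign ((derivRem p).eval₂ φ z) := by
  have : (derivRem p).eval₂ φ z = p.natDegree * p.eval₂ φ z := by
    rw [derivRem, Polynomial.eval₂_sub, Polynomial.eval₂_mul, Polynomial.eval₂_mul, hz,
      Polynomial.eval₂_C]
    simp
  have hpos : (0 : R) < p.natDegree := Nat.cast_pos.2 (Nat.pos_of_ne_zero hp)
  rw [this, sign_mul, sign_pos hpos, one_mul]

theorem map_leadingCoeff_ne_zero_of_map_ne_zero {g : Polynomial A} {φ : A →+* R}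
    (h : g.natDegree ≠ 0 → φ g.leadingCoeff ≠ 0) (hg : g.map φ ≠ 0) : φ g.leadingCoeff ≠ 0 := by
  by_cases h0 : g.natDegree = 0
  · intro h1
    rw [Polynomial.leadingCoeff, h0] at h1
    rw [Polynomial.eq_C_of_natDegree_eq_zero h0] at hg
    simp [h1] at hg
  · exact h h0

theorem isDershowitzMannaLT_cons_erase {α : Type*} [DecidableEq α] {P : Multiset α} {d : α → ℕ}
    {a : α} (ha : a ∈ P) (N : Multiset α) (hN : ∀ b ∈ N, d b < d a) :
    Multiset.IsDershowitzMannaLT ((P.erase a + N).map d) (P.map d) := by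
  refine ⟨(P.erase a).map d, N.map d, {d a}, by simp, by simp, ?_, by simpa using hN⟩
  conv_lhs => rw [← Multiset.cons_erase ha]
  rw [Multiset.map_cons, add_comm, Multiset.singleton_add]

/-- Whether the signs of finitely many polynomials over `A` behave in the same way along two
homomorphisms to ordered fields is controlled by the signs of finitely many elements of `A`. -/
theorem exists_finset_signSim (hR : PolynomialIVT R) (hS : PolynomialIVT S)
    (P : Multiset (Polynomial A)) :
    ∃ Q : Finset A, ∀ (φ : A →+* R) (ψ : A →+* S), (∀ a ∈ Q, sign (φ a) = sign (ψ a)) →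
      SignSim {p | p ∈ P} φ ψ ∧ SignSim {p | p ∈ P} ψ φ := by
  classical
  induction P using (InvImage.wf (fun P : Multiset (Polynomial A) => P.map Polynomial.natDegree)
    Multiset.wellFounded_isDershowitzMannaLT).induction with
  | _ P ih =>
  by_cases hconst : ∀ p ∈ P, p.natDegree = 0
  · refine ⟨P.toFinset.image Polynomial.leadingCoeff, fun φ ψ h => ?_⟩
    have h' : ∀ p ∈ P, sign (φ p.leadingCoeff) = sign (ψ p.leadingCoeff) := fun p hp =>
      h _ (Finset.mem_image_of_mem _ (Multiset.mem_toFinset.2 hp))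
    exact ⟨signSim_of_forall_natDegree_eq_zero hconst h',
      signSim_of_forall_natDegree_eq_zero hconst fun p hp => (h' p hp).symm⟩
  push Not at hconst
  obtain ⟨p, hp, hpmax⟩ : ∃ p ∈ P, ∀ g ∈ P, g.natDegree ≤ p.natDegree := by
    obtain ⟨p₀, hp₀, -⟩ := hconst
    obtain ⟨p, hp, hmax⟩ := P.toFinset.exists_max_image Polynomial.natDegree
      ⟨p₀, Multiset.mem_toFinset.2 hp₀⟩
    exact ⟨p, Multiset.mem_toFinset.1 hp, fun g hg => hmax g (Multiset.mem_toFinset.2 hg)⟩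
  have hp0 : p.natDegree ≠ 0 := by
    obtain ⟨p₀, hp₀, h0⟩ := hconst
    have := hpmax p₀ hp₀
    omega
  let N : Multiset (Polynomial A) :=
    Polynomial.derivative p ::ₘ derivRem p ::ₘ (P.erase p).map (pseudoRem p)
  obtain ⟨Q₁, hQ₁⟩ := ih (P.erase p + N) (isDershowitzMannaLT_cons_erase hp N fun g hg => by
    simp only [N, Multiset.mem_cons, Multiset.mem_map] at hg
    rcases hg with rfl | rfl | ⟨g, hg, rfl⟩
    · exact Polynomial.natDegree_derivative_lt hp0
    · exact natDegree_derivRem_lt hp0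
    · exact natDegree_pseudoRem_lt hp0 (hpmax g (Multiset.mem_of_mem_erase hg)))
  have herase : ∀ g : Polynomial A, ∃ Q : Finset A, g ∈ P → g.natDegree ≠ 0 →
      ∀ (φ : A →+* R) (ψ : A →+* S), (∀ a ∈ Q, sign (φ a) = sign (ψ a)) →
        SignSim {q | q ∈ P.erase g + {g.eraseLead}} φ ψ ∧
        SignSim {q | q ∈ P.erase g + {g.eraseLead}} ψ φ := fun g => by
    by_cases hg : g ∈ P ∧ g.natDegree ≠ 0
    · obtain ⟨Q, hQ⟩ := ih (P.erase g + {g.eraseLead})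
        (isDershowitzMannaLT_cons_erase hg.1 _ (by
          have := g.eraseLead_natDegree_le
          have := Nat.pos_of_ne_zero hg.2
          simp
          omega))
      exact ⟨Q, fun _ _ => hQ⟩
    · exact ⟨∅, fun h1 h2 => absurd ⟨h1, h2⟩ hg⟩
  choose Q₂ hQ₂ using herase
  refine ⟨P.toFinset.image Polynomial.leadingCoeff ∪ P.toFinset.biUnion Q₂ ∪ Q₁,
    fun φ ψ h => ?_⟩
  simp only [Finset.mem_union, Finset.mem_image, Finset.mem_biUnion, Multiset.mem_toFinset] at h
  have hlead : ∀ g ∈ P, sign (φ g.leadingCoeff) = sign (ψ g.leadingCoeff) := fun g hg =>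
    h _ (.inl (.inl ⟨g, hg, rfl⟩))
  by_cases hg : ∃ g ∈ P, g.natDegree ≠ 0 ∧ φ g.leadingCoeff = 0
  · obtain ⟨g, hgP, hg0, hgφ⟩ := hg
    have hgψ : ψ g.leadingCoeff = 0 := by
      rw [← sign_eq_zero_iff, ← hlead g hgP, hgφ, sign_zero]
    obtain ⟨h1, h2⟩ := hQ₂ g hgP hg0 φ ψ fun a ha => h a (.inl (.inr ⟨g, hgP, ha⟩))
    have hcongr : ∀ q ∈ P, ∃ q' ∈ P.erase g + {g.eraseLead},
        (∀ x, q.eval₂ φ x = q'.eval₂ φ x) ∧ ∀ x, q.eval₂ ψ x = q'.eval₂ ψ x := fun q hq => by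
      by_cases hqg : q = g
      · subst hqg
        exact ⟨q.eraseLead, by simp, eval₂_eraseLead_of_map_eq_zero hgφ,
          eval₂_eraseLead_of_map_eq_zero hgψ⟩
      · exact ⟨q, Multiset.mem_add.2 (.inl ((Multiset.mem_erase_of_ne hqg).2 hq)),
          fun _ => rfl, fun _ => rfl⟩
    exact ⟨h1.congr hcongr, h2.congr fun q hq => by
      obtain ⟨q', hq', h3, h4⟩ := hcongr q hq
      exact ⟨q', hq', h4, h3⟩⟩
  push Not at hg
  have hψ : ∀ g ∈ P, g.natDegree ≠ 0 → ψ g.leadingCoeff ≠ 0 := fun g hgP hg0 => by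
    rw [← sign_ne_zero, ← hlead g hgP, sign_ne_zero]
    exact hg g hgP hg0
  obtain ⟨h1, h2⟩ := hQ₁ φ ψ fun a ha => h a (.inr ha)
  let L := (Polynomial.derivative p ::ₘ P.erase p).toFinset
  let L' := (P.erase p + N).toFinset
  have hsub : L ⊆ L' := fun q hq => by
    simp only [L, L', N, Multiset.mem_toFinset, Multiset.mem_cons, Multiset.mem_add] at hq ⊢
    tauto
  have hrem : ∀ g ∈ L, ∃ r ∈ L',
      (g.map φ ≠ 0 → ∀ z, g.eval₂ φ z = 0 → sign (p.eval₂ φ z) = sign (r.eval₂ φ z)) ∧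
      (g.map ψ ≠ 0 → ∀ z, g.eval₂ ψ z = 0 → sign (p.eval₂ ψ z) = sign (r.eval₂ ψ z)) := by
    intro g hgL
    rcases Multiset.mem_cons.1 (Multiset.mem_toFinset.1 hgL) with rfl | hgP
    · exact ⟨derivRem p, by simp [L', N], fun _ _ => sign_eval₂_derivRem hp0,
        fun _ _ => sign_eval₂_derivRem hp0⟩
    · refine ⟨pseudoRem p g, Multiset.mem_toFinset.2 (Multiset.mem_add.2 (.inr
        (Multiset.mem_cons_of_mem (Multiset.mem_cons_of_mem (Multiset.mem_map_of_mem _ hgP))))),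
        fun h0 _ => sign_eval₂_pseudoRem (map_leadingCoeff_ne_zero_of_map_ne_zero
          (hg g (Multiset.mem_of_mem_erase hgP)) h0),
        fun h0 _ => sign_eval₂_pseudoRem (map_leadingCoeff_ne_zero_of_map_ne_zero
          (hψ g (Multiset.mem_of_mem_erase hgP)) h0)⟩
  have hLp : {q | q ∈ P} ⊆ (insert p L : Set (Polynomial A)) := fun q hq => by
    by_cases hqp : q = p
    · exact .inl hqp
    · exact .inr (Multiset.mem_toFinset.2
        (Multiset.mem_cons_of_mem ((Multiset.mem_erase_of_ne hqp).2 hq)))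
  have hL : Polynomial.derivative p ∈ L := by simp [L]
  have h1' : SignSim (L' : Set (Polynomial A)) φ ψ := h1.mono fun q hq => by simpa [L'] using hq
  have h2' : SignSim (L' : Set (Polynomial A)) ψ φ := h2.mono fun q hq => by simpa [L'] using hq
  exact ⟨(SignSim.adjoin hR hS hL hp0 (hlead p hp) (hg p hp hp0) hsub hrem h1' h2').mono hLp,
    (SignSim.adjoin hS hR hL hp0 (hlead p hp).symm (hψ p hp hp0) hsub
      (fun g hgL => by
        obtain ⟨r, hr, h3, h4⟩ := hrem g hgL
        exact ⟨r, hr, h4, h3⟩) h2' h1').mono hLp⟩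

end SignElimination

section RealClosure

/-- A field in which `f` is not a sum of squares, but becomes one after adjoining a root of any
irreducible polynomial of degree at least two; the second condition is expressed by lifting the
resulting identity to polynomials. -/
structure SumSqMaximal {R : Type*} [Field R] (f : R) : Prop where
  not_isSumSq : ¬ IsSumSq f
  exists_lift : ∀ p : Polynomial R, Irreducible p → 2 ≤ p.natDegree → ∃ G h : Polynomial R,
    G = .C f + p * h ∧ G.natDegree ≤ 2 * (p.natDegree - 1) ∧ (∀ a, IsSumSq (G.eval a)) ∧
      IsSumSq (G.coeff (2 * (p.natDegree - 1)))

theorem isSumSq_of_isSumSq_mul {R : Type*} [Field R] (c : R) {a : R} (hc : IsSumSq c) (h0 : c ≠ 0) (h : IsSumSq (a * c)) :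
    IsSumSq a := by
  have : a = a * c * c * (c⁻¹ * c⁻¹) := by field_simp
  rw [this]
  exact (h.mul hc).mul (IsSumSq.mul_self _)

theorem isSumSq_of_mem_closure {Ω : Type*} [Field Ω] (E : Subfield Ω) {y : Ω}
    (hy : y ∈ AddSubmonoid.closure {y : Ω | ∃ x ∈ E, y = x * x}) : ∃ z : E, IsSumSq z ∧ (z : Ω) = y := by
  induction hy using AddSubmonoid.closure_induction with
  | mem y hy =>
    obtain ⟨x, hx, rfl⟩ := hy
    exact ⟨⟨x, hx⟩ * ⟨x, hx⟩, IsSumSq.mul_self _, rfl⟩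
  | zero => exact ⟨0, IsSumSq.zero, rfl⟩
  | add x y _ _ hx hy =>
    obtain ⟨a, ha, rfl⟩ := hx
    obtain ⟨b, hb, rfl⟩ := hy
    exact ⟨a + b, ha.add hb, rfl⟩

theorem mem_closure_of_isSumSq {K Ω : Type*} [Field K] [Field Ω] (φ : K →+* Ω) (E : Subfield Ω)
    (hE : ∀ x, φ x ∈ E) {y : K} (hy : IsSumSq y) :
    φ y ∈ AddSubmonoid.closure {y : Ω | ∃ x ∈ E, y = x * x} := by
  induction hy using IsSumSq.rec' with
  | zero => simp
  | sq_add hx _ hs =>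
    obtain ⟨a, rfl⟩ := hx
    rw [map_add]
    exact add_mem (AddSubmonoid.subset_closure ⟨φ a, hE a, map_mul φ a a⟩) hs

theorem exists_lift_of_mem_closure {Ω : Type*} [Field Ω] {E : Subfield Ω} {p : Polynomial E}
    (hp : Irreducible p) {α : Ω} (hα : Polynomial.aeval α p = 0) {y : Ω}
    (hy : y ∈ AddSubmonoid.closure
      {y : Ω | ∃ x ∈ (IntermediateField.adjoin E {α}).toSubfield, y = x * x}) :
    ∃ G : Polynomial E, Polynomial.aeval α G = y ∧ G.natDegree ≤ 2 * (p.natDegree - 1) ∧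
      (∀ a, IsSumSq (G.eval a)) ∧ IsSumSq (G.coeff (2 * (p.natDegree - 1))) := by
  induction hy using AddSubmonoid.closure_induction with
  | mem y hy =>
    obtain ⟨x, hx, rfl⟩ := hy
    have hx' : x ∈ (IntermediateField.adjoin E {α}).toSubalgebra := hx
    rw [IntermediateField.adjoin_simple_toSubalgebra_of_isAlgebraic ⟨p, hp.ne_zero, hα⟩,
      Algebra.adjoin_singleton_eq_range_aeval] at hx'
    obtain ⟨g, rfl⟩ := hx'
    have hdeg : (g % p).natDegree ≤ p.natDegree - 1 := by
      have := Polynomial.natDegree_mod_lt g hp.natDegree_pos.ne'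
      omega
    have hg : Polynomial.aeval α (g % p) = Polynomial.aeval α g := by
      conv_rhs => rw [← EuclideanDomain.div_add_mod g p]
      simp [hα]
    refine ⟨g % p * (g % p), by rw [map_mul, hg]; rfl, ?_, fun a => ?_, ?_⟩
    · refine Polynomial.natDegree_mul_le.trans ?_
      omega
    · rw [Polynomial.eval_mul]
      exact IsSumSq.mul_self _
    · rw [two_mul, Polynomial.coeff_mul_add_eq_of_natDegree_le hdeg hdeg]
      exact IsSumSq.mul_self _
  | zero => exact ⟨0, by simp, by simp, by simp, by simp⟩
  | add x y _ _ hx hy =>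
    obtain ⟨G, rfl, h1, h2, h3⟩ := hx
    obtain ⟨G', rfl, h1', h2', h3'⟩ := hy
    exact ⟨G + G', map_add _ _ _, Polynomial.natDegree_add_le_of_degree_le h1 h1',
      fun a => by simpa using (h2 a).add (h2' a), by simpa using h3.add h3'⟩

theorem mem_closure_of_mem_closure_sSup {Ω : Type*} [Field Ω] {c : Set (Subfield Ω)}
    (hc : IsChain (· ≤ ·) c) (hne : c.Nonempty) {y : Ω}
    (hy : y ∈ AddSubmonoid.closure {y : Ω | ∃ x ∈ sSup c, y = x * x}) :
    ∃ E ∈ c, y ∈ AddSubmonoid.closure {y : Ω | ∃ x ∈ E, y = x * x} := by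
  induction hy using AddSubmonoid.closure_induction with
  | mem y hy =>
    obtain ⟨x, hx, rfl⟩ := hy
    obtain ⟨E, hE, hxE⟩ := (Subfield.mem_sSup_of_directedOn hne hc.directedOn).1 hx
    exact ⟨E, hE, AddSubmonoid.subset_closure ⟨x, hxE, rfl⟩⟩
  | zero =>
    obtain ⟨E, hE⟩ := hne
    exact ⟨E, hE, zero_mem _⟩
  | add x y _ _ hx hy =>
    obtain ⟨E, hE, hx⟩ := hx
    obtain ⟨E', hE', hy⟩ := hy
    obtain ⟨E'', hE'', h1, h2⟩ := hc.directedOn E hE E' hE'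
    exact ⟨E'', hE'', add_mem
      (AddSubmonoid.closure_mono (fun z hz => hz.imp fun x hx => ⟨h1 hx.1, hx.2⟩) hx)
      (AddSubmonoid.closure_mono (fun z hz => hz.imp fun x hx => ⟨h2 hx.1, hx.2⟩) hy)⟩

theorem exists_sumSqMaximal {K : Type*} [Field K] {f : K} (hf : ¬ IsSumSq f) :
    ∃ (E : Subfield (AlgebraicClosure K)) (φ : K →+* E), SumSqMaximal (φ f) := by
  let ι := algebraMap K (AlgebraicClosure K)
  let S : Set (Subfield (AlgebraicClosure K)) := {E | (∀ x, ι x ∈ E) ∧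
    ι f ∉ AddSubmonoid.closure {y | ∃ x ∈ E, y = x * x}}
  have hmem : ι.fieldRange ∈ S := by
    refine ⟨fun x => ⟨x, rfl⟩, fun h => hf ?_⟩
    obtain ⟨z, hz, hzf⟩ := isSumSq_of_mem_closure _ h
    have : ∀ z : ι.fieldRange, IsSumSq z → ∃ y, IsSumSq y ∧ ι y = z := fun z hz => by
      induction hz using IsSumSq.rec' with
      | zero => exact ⟨0, IsSumSq.zero, map_zero ι⟩
      | sq_add hx _ hs =>
        obtain ⟨⟨_, a, rfl⟩, rfl⟩ := hx
        obtain ⟨s, hs, hs'⟩ := hs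
        exact ⟨a * a + s, (IsSumSq.mul_self a).add hs, by simp [hs']⟩
    obtain ⟨y, hy, hyz⟩ := this z hz
    rwa [← ι.injective (hyz.trans hzf)]
  obtain ⟨E, -, hE⟩ := zorn_le_nonempty₀ S (fun c hcS hc E hE => by
    refine ⟨sSup c, ⟨fun x => ?_, fun h => ?_⟩, fun z hz => le_sSup hz⟩
    · exact le_sSup hE ((hcS hE).1 x)
    · obtain ⟨E', hE', h'⟩ := mem_closure_of_mem_closure_sSup hc ⟨E, hE⟩ h
      exact (hcS hE').2 h') _ hmem
  refine ⟨E, ι.codRestrict E hE.prop.1, fun h => hE.prop.2 ?_, fun p hp hdeg => ?_⟩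
  · exact mem_closure_of_isSumSq (algebraMap E _) E (fun x => x.2) h
  obtain ⟨α, hα⟩ := IsAlgClosed.exists_aeval_eq_zero (AlgebraicClosure K) p
    (Polynomial.degree_pos_of_irreducible hp).ne'
  have hαE : α ∉ E := fun h => by
    have hroot : p.IsRoot ⟨α, h⟩ := by
      refine Subtype.ext ?_
      have := Polynomial.aeval_algebraMap_apply (AlgebraicClosure K) (⟨α, h⟩ : E) p
      rw [Polynomial.coe_aeval_eq_eval] at this
      exact this.symm.trans hα
    have := Polynomial.natDegree_eq_of_degree_eq_some (n := 1)
      (Polynomial.degree_eq_one_of_irreducible_of_root hp hroot)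
    omega
  have hle : E ≤ (IntermediateField.adjoin E {α}).toSubfield := fun x hx =>
    (IntermediateField.adjoin E {α}).algebraMap_mem ⟨x, hx⟩
  have hf' : ι f ∈ AddSubmonoid.closure
      {y | ∃ x ∈ (IntermediateField.adjoin E {α}).toSubfield, y = x * x} := by
    by_contra hcon
    have := hE.le_of_ge (y := (IntermediateField.adjoin E {α}).toSubfield)
      ⟨fun x => hle (hE.prop.1 x), hcon⟩ hle
    exact hαE (this (IntermediateField.mem_adjoin_simple_self E α))
  obtain ⟨G, hG, h1, h2, h3⟩ := exists_lift_of_mem_closure hp hα hf'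
  have hdvd : p ∣ G - .C (ι.codRestrict E hE.prop.1 f) := by
    have h0 := minpoly.dvd E α (p := G - .C (ι.codRestrict E hE.prop.1 f)) (by
      rw [map_sub, hG, Polynomial.aeval_C]
      exact sub_self _)
    rw [← minpoly.eq_of_irreducible hp hα] at h0
    exact (dvd_mul_right _ _).trans h0
  obtain ⟨h, hh⟩ := hdvd
  exact ⟨G, h, by rw [← hh]; ring, h1, h2, h3⟩

namespace SumSqMaximal

variable {R : Type*} [Field R] {f : R}

theorem exists_of_not_isSquare (H : SumSqMaximal f) {a : R} (ha : ¬ IsSquare a) :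
    ∃ c, IsSumSq c ∧ IsSumSq (f - a * c) := by
  have hdeg : (.X ^ 2 - .C a : Polynomial R).natDegree = 2 := Polynomial.natDegree_X_pow_sub_C
  have hirr : Irreducible (.X ^ 2 - .C a : Polynomial R) := by
    refine Polynomial.irreducible_of_degree_le_three_of_not_isRoot (by rw [hdeg]; simp) fun x hx => ?_
    refine ha ⟨x, ?_⟩
    simp [sub_eq_zero] at hx
    rw [← hx, sq]
  obtain ⟨G, h, hG, h1, h2, h3⟩ := H.exists_lift _ hirr hdeg.ge
  rw [hdeg] at h1 h3
  have hh : h.natDegree = 0 := by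
    by_contra hh
    have h0 : h ≠ 0 := fun h0 => hh (by simp [h0])
    have := Polynomial.natDegree_mul hirr.ne_zero h0
    rw [← sub_eq_of_eq_add' hG, hdeg] at this
    have := Polynomial.natDegree_sub_C (p := G) (a := f)
    omega
  rw [Polynomial.eq_C_of_natDegree_eq_zero hh] at hG
  refine ⟨h.coeff 0, ?_, ?_⟩
  · convert h3 using 1
    simp [hG]
  · convert h2 0 using 1
    simp [hG]
    ring

variable [CharZero R]

theorem not_isSumSq_neg_one (H : SumSqMaximal f) : ¬ IsSumSq (-1 : R) := fun h => by
  refine H.not_isSumSq ?_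
  have : f = (f + 1) / 2 * ((f + 1) / 2) + -1 * ((f - 1) / 2 * ((f - 1) / 2)) := by ring
  rw [this]
  exact (IsSumSq.mul_self _).add (h.mul (IsSumSq.mul_self _))

theorem eq_zero_of_add_eq_zero (H : SumSqMaximal f) {s t : R} (hs : IsSumSq s) (ht : IsSumSq t)
    (h : s + t = 0) : s = 0 := by
  by_contra h0
  refine H.not_isSumSq_neg_one (isSumSq_of_isSumSq_mul s hs h0 ?_)
  rwa [neg_one_mul, ← eq_neg_of_add_eq_zero_right h]

theorem isSquare_neg (H : SumSqMaximal f) : IsSquare (-f) := by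
  by_contra h
  obtain ⟨c, hc, hs⟩ := H.exists_of_not_isSquare h
  refine H.not_isSumSq (isSumSq_of_isSumSq_mul (1 + c) (IsSumSq.one.add hc) (fun h0 => ?_) ?_)
  · exact one_ne_zero (H.eq_zero_of_add_eq_zero IsSumSq.one hc h0)
  · rwa [mul_add, mul_one, ← sub_neg_eq_add, ← neg_mul]

theorem isSumSq_neg_of_not_isSquare (H : SumSqMaximal f) {a : R} (ha : ¬ IsSquare a) :
    IsSumSq (-a) := by
  obtain ⟨c, hc, hs⟩ := H.exists_of_not_isSquare ha
  refine isSumSq_of_isSumSq_mul c hc (fun h0 => H.not_isSumSq (by simpa [h0] using hs)) ?_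
  have := hs.add H.isSquare_neg.isSumSq
  rwa [← sub_eq_add_neg, sub_right_comm, sub_self, zero_sub, ← neg_mul] at this

theorem isSquare_of_isSumSq (H : SumSqMaximal f) {a : R} (ha : IsSumSq a) : IsSquare a := by
  by_contra h
  have := H.eq_zero_of_add_eq_zero ha (H.isSumSq_neg_of_not_isSquare h) (by ring)
  exact h (this ▸ IsSquare.zero)

theorem isSquare_or_isSquare_neg (H : SumSqMaximal f) (a : R) : IsSquare a ∨ IsSquare (-a) :=
  or_iff_not_imp_left.2 fun h => H.isSquare_of_isSumSq (H.isSumSq_neg_of_not_isSquare h)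

/-- The cone of squares. -/
def cone (H : SumSqMaximal f) : RingCone R where
  carrier := {a | IsSquare a}
  mul_mem' := IsSquare.mul
  one_mem' := IsSquare.one
  add_mem' ha hb := H.isSquare_of_isSumSq (ha.isSumSq.add hb.isSumSq)
  zero_mem' := IsSquare.zero
  eq_zero_of_mem_of_neg_mem' ha hb :=
    H.eq_zero_of_add_eq_zero ha.isSumSq hb.isSumSq (add_neg_cancel _)

theorem exists_order (H : SumSqMaximal f) : ∃ (_ : LinearOrder R), IsStrictOrderedRing R ∧
    ∀ a : R, 0 ≤ a → IsSquare a := by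
  classical
  have : HasMemOrNegMem H.cone := ⟨H.isSquare_or_isSquare_neg⟩
  let _ : LinearOrder R := .mkOfAddGroupCone H.cone
  have : IsOrderedRing R := IsOrderedRing.mkOfCone H.cone
  refine ⟨inferInstance, IsOrderedRing.toIsStrictOrderedRing R, fun a ha => ?_⟩
  have : a - 0 ∈ H.cone := ha
  rwa [sub_zero] at this

theorem lt_zero (H : SumSqMaximal f) [LinearOrder R] [IsStrictOrderedRing R] : f < 0 := by
  obtain ⟨g, hg⟩ := H.isSquare_neg
  refine lt_of_le_of_ne ?_ fun h => H.not_isSumSq (h ▸ IsSumSq.zero)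
  rw [← neg_nonneg, hg]
  exact mul_self_nonneg g

theorem polynomialIVT (H : SumSqMaximal f) [LinearOrder R] [IsStrictOrderedRing R] :
    PolynomialIVT R := by
  suffices ∀ n, ∀ p : Polynomial R, p.natDegree = n → ∀ a b, a < b → p.eval a * p.eval b < 0 →
      ∃ c, a < c ∧ c < b ∧ p.eval c = 0 from fun p => this _ p rfl
  intro n
  induction n using Nat.strong_induction_on with
  | _ n ih =>
  intro p hn a b hab hneg
  have hp0 : p ≠ 0 := fun h => by simp [h] at hneg
  have hnunit : ¬ IsUnit p := fun h => by
    obtain ⟨c, -, rfl⟩ := Polynomial.isUnit_iff.1 h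
    simp only [Polynomial.eval_C] at hneg
    exact (mul_self_nonneg c).not_gt hneg
  by_cases hirr : Irreducible p
  · rcases (Nat.one_le_iff_ne_zero.2 hirr.natDegree_pos.ne').eq_or_lt with h1 | h2
    · obtain ⟨m, hm, k, rfl⟩ := Polynomial.natDegree_eq_one.1 h1.symm
      have hfac : ∀ x, m * x + k = m * (x - -k / m) := fun x => by field_simp; ring
      simp only [Polynomial.eval_add, Polynomial.eval_mul, Polynomial.eval_C, Polynomial.eval_X,
        hfac] at hneg ⊢
      have h' : (a - -k / m) * (b - -k / m) < 0 := by
        by_contra hcon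
        nlinarith [mul_nonneg (mul_self_nonneg m) (not_lt.1 hcon)]
      refine ⟨-k / m, ?_, ?_, by simp⟩ <;> nlinarith
    · obtain ⟨G, h, hG, hdeg, hev, -⟩ := H.exists_lift p hirr h2
      have hpos : ∀ x, 0 < p.eval x * h.eval x := fun x => by
        have h1 := (hev x).nonneg
        have h2 := H.lt_zero
        simp only [hG, Polynomial.eval_add, Polynomial.eval_mul, Polynomial.eval_C] at h1
        linarith
      have hh0 : h ≠ 0 := fun h0 => by simpa [h0] using hpos 0
      have hhdeg : h.natDegree < n := by
        have h3 := Polynomial.natDegree_mul hp0 hh0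
        rw [← sub_eq_of_eq_add' hG, Polynomial.natDegree_sub_C] at h3
        omega
      obtain ⟨c, -, -, hc⟩ := ih _ hhdeg h rfl a b hab (by
        have := mul_pos (hpos a) (hpos b)
        by_contra hcon
        nlinarith [mul_nonneg (neg_nonneg.2 hneg.le) (not_lt.1 hcon)])
      simpa [hc] using hpos c
  · obtain ⟨q, r, rfl, hq, hr⟩ : ∃ q r, p = q * r ∧ ¬ IsUnit q ∧ ¬ IsUnit r := by
      simpa [irreducible_iff, hnunit] using hirr
    have hq0 := left_ne_zero_of_mul hp0
    have hr0 := right_ne_zero_of_mul hp0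
    have hqd : q.natDegree ≠ 0 := fun h => hq (Polynomial.isUnit_iff_degree_eq_zero.2
      (by rw [Polynomial.degree_eq_natDegree hq0, h]; rfl))
    have hrd : r.natDegree ≠ 0 := fun h => hr (Polynomial.isUnit_iff_degree_eq_zero.2
      (by rw [Polynomial.degree_eq_natDegree hr0, h]; rfl))
    rw [Polynomial.natDegree_mul hq0 hr0] at hn
    simp only [Polynomial.eval_mul] at hneg ⊢
    by_cases hlt : q.eval a * q.eval b < 0
    · obtain ⟨c, h1, h2, h3⟩ := ih _ (by omega) q rfl a b hab hlt
      exact ⟨c, h1, h2, by rw [h3, zero_mul]⟩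
    · obtain ⟨c, h1, h2, h3⟩ := ih _ (by omega) r rfl a b hab (by
        by_contra hcon
        nlinarith [mul_nonneg (not_lt.1 hlt) (not_lt.1 hcon)])
      exact ⟨c, h1, h2, by rw [h3, mul_zero]⟩

end SumSqMaximal

end RealClosure

section Artin

theorem polynomialIVT_real : PolynomialIVT ℝ := fun p a b hab h => by
  have hc : ContinuousOn (fun x => p.eval x) (Set.Icc a b) := p.continuous.continuousOn
  rcases mul_neg_iff.1 h with ⟨ha, hb⟩ | ⟨ha, hb⟩
  · obtain ⟨c, hc, h0⟩ := intermediate_value_Ioo' hab.le hc ⟨hb, ha⟩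
    exact ⟨c, hc.1, hc.2, h0⟩
  · obtain ⟨c, hc, h0⟩ := intermediate_value_Ioo hab.le hc ⟨ha, hb⟩
    exact ⟨c, hc.1, hc.2, h0⟩

theorem sign_ringHom_real {R : Type*} [Field R] [LinearOrder R] [IsStrictOrderedRing R]
    (ι : ℝ →+* R) (x : ℝ) : sign (ι x) = sign x := by
  have hnn : ∀ y : ℝ, 0 ≤ y → 0 ≤ ι y := fun y hy => by
    rw [← Real.mul_self_sqrt hy, map_mul]
    exact mul_self_nonneg _
  have hpos : ∀ y : ℝ, 0 < y → 0 < ι y := fun y hy =>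
    (hnn y hy.le).lt_of_ne fun h => hy.ne' ((map_eq_zero ι).1 h.symm)
  rcases lt_trichotomy x 0 with h | rfl | h
  · rw [sign_neg h, sign_neg]
    simpa using hpos (-x) (neg_pos.2 h)
  · simp
  · rw [sign_pos h, sign_pos (hpos x h)]

theorem eval₂_eq_eval₂_finSuccEquiv {k R : Type*} [CommRing k] [CommRing R] {n : ℕ} (ι : k →+* R)
    (a : Fin (n + 1) → R) (p : MvPolynomial (Fin (n + 1)) k) :
    eval₂ ι a p = (finSuccEquiv k n p).eval₂ (eval₂Hom ι fun i => a i.succ) (a 0) := by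
  have : eval₂Hom ι a = (Polynomial.eval₂RingHom (eval₂Hom ι fun i => a i.succ) (a 0)).comp
      (finSuccEquiv k n : _ →+* Polynomial (MvPolynomial (Fin n) k)) := by
    refine MvPolynomial.ringHom_ext (fun r => ?_) fun i => ?_
    · simp [finSuccEquiv_apply]
    · refine Fin.cases ?_ (fun i => ?_) i <;> simp [finSuccEquiv_X_zero, finSuccEquiv_X_succ]
  exact congrArg (fun g => g p) this

/-- The signs taken by finitely many real polynomials at a point of a suitable ordered extension of
`ℝ` are also taken at a real point. -/
theorem exists_forall_sign_eval_eq {R : Type*} [Field R] [LinearOrder R] [IsStrictOrderedRing R]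
    (hR : PolynomialIVT R) (ι : ℝ →+* R) : ∀ (n : ℕ) (P : Finset (MvPolynomial (Fin n) ℝ))
      (a : Fin n → R), ∃ b : Fin n → ℝ, ∀ p ∈ P, sign (eval₂ ι a p) = sign (eval b p)
  | 0, P, a => ⟨Fin.elim0, fun p _ => by
      rw [p.eq_C_of_isEmpty, eval₂_C, eval_C, sign_ringHom_real]⟩
  | n + 1, P, a => by
      classical
      obtain ⟨Q, hQ⟩ := exists_finset_signSim hR polynomialIVT_real (P.image (finSuccEquiv ℝ n)).1
      obtain ⟨b, hb⟩ := exists_forall_sign_eval_eq hR ι n Q fun i => a i.succ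
      obtain ⟨f, -, hf⟩ := (hQ (eval₂Hom ι fun i => a i.succ) (eval b) hb).1 {a 0}
      refine ⟨Fin.cons (f (a 0)) b, fun p hp => ?_⟩
      rw [eval₂_eq_eval₂_finSuccEquiv, hf _ (Finset.mem_singleton_self _) _
        (Finset.mem_image_of_mem _ hp)]
      exact congrArg sign (eval₂_eq_eval₂_finSuccEquiv (RingHom.id ℝ)
        (Fin.cons (f (a 0)) b : Fin (n + 1) → ℝ) p).symm

/-- **Artin's theorem**: a nonnegative real polynomial is a sum of squares of rational functions. -/
theorem isSumSq_algebraMap_of_nonneg {d : ℕ} (K : Type*) [Field K]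
    [Algebra (MvPolynomial (Fin d) ℝ) K] {f : MvPolynomial (Fin d) ℝ} (hf : ∀ x, 0 ≤ eval x f) :
    IsSumSq (algebraMap (MvPolynomial (Fin d) ℝ) K f) := by
  by_contra h
  obtain ⟨E, φ, H⟩ := exists_sumSqMaximal h
  let g : MvPolynomial (Fin d) ℝ →+* E := φ.comp (algebraMap _ K)
  let ι : ℝ →+* E := g.comp C
  have := charZero_of_injective_ringHom ι.injective
  obtain ⟨_, _, -⟩ := H.exists_order
  obtain ⟨b, hb⟩ := exists_forall_sign_eval_eq H.polynomialIVT ι d {f} fun i => g (X i)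
  have hb := hb f (Finset.mem_singleton_self f)
  have hg : eval₂ ι (fun i => g (X i)) f = g f := by
    have : eval₂Hom ι (fun i => g (X i)) = g := MvPolynomial.ringHom_ext (by simp [ι]) (by simp)
    exact congrArg (fun g => g f) this
  rw [hg, show sign (g f) = -1 from sign_neg H.lt_zero] at hb
  exact (hf b).not_gt (sign_eq_neg_one_iff.1 hb.symm)

end Artin

section SymmetricMatrix

theorem IsSumSq.exists_fin_sum {K : Type*} [Semiring K] {x : K} (hx : IsSumSq x) :
    ∃ (n : ℕ) (c : Fin n → K), x = ∑ l, c l * c l := by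
  induction hx using IsSumSq.rec' with
  | zero => exact ⟨0, Fin.elim0, by simp⟩
  | sq_add hx _ hs =>
    obtain ⟨a, rfl⟩ := hx
    obtain ⟨n, c, rfl⟩ := hs
    exact ⟨n + 1, Fin.cons a c, by simp [Fin.sum_univ_succ]⟩

/-- A symmetric matrix over a field of characteristic not two is congruent to a diagonal one, whose
entries are values of the quadratic form. -/
theorem exists_diagonalization {K ι : Type*} [Field K] [Invertible (2 : K)] [Fintype ι]
    [DecidableEq ι] {S : Matrix ι ι K} (hS : S.IsSymm) :
    ∃ (n : ℕ) (v w : Fin n → ι → K), ∀ a b, S a b =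
      ∑ i, (∑ a, ∑ b, v i a * S a b * v i b) * (w i a * w i b) := by
  obtain ⟨v, hv⟩ := LinearMap.BilinForm.exists_orthogonal_basis
    (B := Matrix.toBilin' S) ⟨(Matrix.isSymm_toBilin'_iff_isSymm.2 hS).eq⟩
  refine ⟨_, v, fun i a => v.repr (Pi.single a 1) i, fun a b => ?_⟩
  simp_rw [← Matrix.toBilin'_apply]
  conv_lhs => rw [← Matrix.toBilin'_single S a b, ← v.sum_repr (Pi.single a 1),
    ← v.sum_repr (Pi.single b 1)]
  simp only [map_sum, LinearMap.sum_apply, map_smul, LinearMap.smul_apply, smul_eq_mul]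
  refine Finset.sum_congr rfl fun i _ => ?_
  rw [Finset.sum_eq_single i (fun j _ hj => by simp [show Matrix.toBilin' S (v j) (v i) = 0 from hv hj]) (by simp)]
  ring

theorem exists_sq_mul_eq_sum {d : ℕ} {ι : Type*} [Fintype ι] [DecidableEq ι]
    {S : Matrix ι ι (MvPolynomial (Fin d) ℝ)} (hS : S.IsSymm)
    (hpos : ∀ (x : Fin d → ℝ) (v : ι → ℝ), 0 ≤ ∑ a, ∑ b, v a * eval x (S a b) * v b) :
    ∃ s : MvPolynomial (Fin d) ℝ, s ≠ 0 ∧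
      ∃ (k : ℕ) (N : ι → Fin k → MvPolynomial (Fin d) ℝ),
        ∀ a b, s ^ 2 * S a b = ∑ l, N a l * N b l := by
  let K := FractionRing (MvPolynomial (Fin d) ℝ)
  let φ := algebraMap (MvPolynomial (Fin d) ℝ) K
  have : CharZero K := charZero_of_injective_ringHom (φ.comp C).injective
  have : Invertible (2 : K) := invertibleOfNonzero two_ne_zero
  obtain ⟨n, v, w, hvw⟩ := exists_diagonalization (S := S.map φ) (by
    rw [Matrix.IsSymm, ← Matrix.transpose_map, hS])
  have hsq : ∀ i, IsSumSq (∑ a, ∑ b, v i a * S.map φ a b * v i b) := fun i => by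
    obtain ⟨q, hq⟩ := IsLocalization.exist_integer_multiples_of_finite
      (nonZeroDivisors (MvPolynomial (Fin d) ℝ)) (v i)
    choose V hV using hq
    have hq0 : φ q ≠ 0 := IsFractionRing.to_map_ne_zero_of_mem_nonZeroDivisors q.2
    have hnn := isSumSq_algebraMap_of_nonneg K (f := ∑ a, ∑ b, V a * S a b * V b) fun x => by
      simpa using hpos x fun a => eval x (V a)
    refine isSumSq_of_isSumSq_mul (φ q * φ q) (IsSumSq.mul_self _) (mul_ne_zero hq0 hq0) ?_
    convert hnn using 1
    simp only [map_sum, map_mul, hV, Algebra.smul_def, Matrix.map_apply]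
    rw [Finset.sum_mul]
    refine Finset.sum_congr rfl fun a _ => ?_
    rw [Finset.sum_mul]
    refine Finset.sum_congr rfl fun b _ => ?_
    simp only [φ]
    ring
  choose k c hc using fun i => (hsq i).exists_fin_sum
  obtain ⟨s, hs⟩ := IsLocalization.exist_integer_multiples_of_finite
    (nonZeroDivisors (MvPolynomial (Fin d) ℝ))
    (fun t : ι × (Σ i, Fin (k i)) => w t.2.1 t.1 * c t.2.1 t.2.2)
  choose N hN using hs
  let e := Fintype.equivFin (Σ i, Fin (k i))
  refine ⟨s, nonZeroDivisors.ne_zero s.2, _, fun a l => N (a, e.symm l), fun a b => ?_⟩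
  refine IsFractionRing.injective (MvPolynomial (Fin d) ℝ) K ?_
  rw [e.symm.sum_comp fun l => N (a, l) * N (b, l)]
  have hab := hvw a b
  simp only [hc] at hab
  simp only [map_mul, map_sum, hN, map_pow, Algebra.smul_def]
  rw [show algebraMap _ K (S a b) = _ from hab, Fintype.sum_sigma, Finset.mul_sum]
  refine Finset.sum_congr rfl fun i _ => ?_
  rw [Finset.sum_mul, Finset.mul_sum]
  refine Finset.sum_congr rfl fun l _ => ?_
  ring

end SymmetricMatrix

section ComplexMatrix

variable {d : ℕ}

theorem exists_eq_toℂ_add_I_mul_toℂ (p : MvPolynomial (Fin d) ℂ) :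
    ∃ a b : MvPolynomial (Fin d) ℝ, p = toℂ a + C Complex.I * toℂ b := by
  induction p using MvPolynomial.induction_on with
  | C z =>
    refine ⟨C z.re, C z.im, ?_⟩
    simp only [toℂ, map_C, ← map_mul, ← map_add]
    congr 1
    simpa [mul_comm] using (Complex.re_add_im z).symm
  | add p q hp hq =>
    obtain ⟨a, b, rfl⟩ := hp
    obtain ⟨a', b', rfl⟩ := hq
    refine ⟨a + a', b + b', ?_⟩
    simp only [toℂ, map_add]
    ring
  | mul_X p i hp =>
    obtain ⟨a, b, rfl⟩ := hp
    refine ⟨a * X i, b * X i, ?_⟩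
    simp only [toℂ, map_mul, map_X]
    ring

theorem eval_toℂ (x : Fin d → ℝ) (p : MvPolynomial (Fin d) ℝ) :
    eval (fun t => (x t : ℂ)) (toℂ p) = (eval x p : ℂ) := by
  rw [toℂ, eval_map]
  exact (eval₂_comp_left (algebraMap ℝ ℂ) (RingHom.id ℝ) x p).symm

theorem conjPoly_toℂ (p : MvPolynomial (Fin d) ℝ) : conjPoly (toℂ p) = toℂ p := by
  rw [conjPoly, toℂ, MvPolynomial.map_map]
  exact congrArg (fun g => MvPolynomial.map g p) (RingHom.ext Complex.conj_ofReal)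

theorem conjPoly_toℂ_add_I_mul_toℂ (a b : MvPolynomial (Fin d) ℝ) :
    conjPoly (toℂ a + C Complex.I * toℂ b) = toℂ a - C Complex.I * toℂ b := by
  have h : ∀ p q, conjPoly (p + C Complex.I * q : MvPolynomial (Fin d) ℂ) =
      conjPoly p - C Complex.I * conjPoly q := fun p q => by
    simp [conjPoly, sub_eq_add_neg]
  rw [h, conjPoly_toℂ, conjPoly_toℂ]

end ComplexMatrix

/-- every `ℂ^{m×m}`-valued PSD polynomial `F` admits a (nonzero) Artin
denominator: a real polynomial `s` such that `s²F = M(z)M(z̄)*` is an SOS polynomial. -/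
theorem matrix_artin_denominator (d m : ℕ)
    (F : Matrix (Fin m) (Fin m) (MvPolynomial (Fin d) ℂ))
    (hPSD : ∀ x : Fin d → ℝ,
      (Matrix.of fun i j => eval (fun t => (x t : ℂ)) (F i j)).PosSemidef) :
    ∃ s : MvPolynomial (Fin d) ℝ, s ≠ 0 ∧
      ∃ (k : ℕ) (M : Matrix (Fin m) (Fin k) (MvPolynomial (Fin d) ℂ)),
        ∀ i j, (toℂ s) ^ 2 * F i j = ∑ l, M i l * conjPoly (M j l) := by
  choose A B hF using fun i j => exists_eq_toℂ_add_I_mul_toℂ (F i j)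
  have hev : ∀ (x : Fin d → ℝ) i j, eval (fun t => (x t : ℂ)) (F i j) =
      (eval x (A i j) : ℂ) + Complex.I * (eval x (B i j) : ℂ) := fun x i j => by
    simp [hF, eval_toℂ]
  have hH : ∀ x i j, eval x (A j i) = eval x (A i j) ∧ eval x (B j i) = -eval x (B i j) :=
    fun x i j => by
      have := (hPSD x).isHermitian.apply i j
      simp only [Matrix.of_apply, hev, Complex.ext_iff] at this
      simp at this
      exact ⟨this.1, by linarith [this.2]⟩
  have hA : ∀ i j, A j i = A i j := fun i j => MvPolynomial.funext fun x => (hH x i j).1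
  have hB : ∀ i j, B j i = -B i j := fun i j => MvPolynomial.funext fun x => by
    rw [(hH x i j).2, map_neg]
  obtain ⟨s, hs, k, N, hN⟩ := exists_sq_mul_eq_sum
    (S := Matrix.fromBlocks (.of A) (-.of B) (.of B) (.of A)) (by
      refine Matrix.IsSymm.fromBlocks (Matrix.ext fun i j => hA i j) ?_
        (Matrix.ext fun i j => hA i j)
      exact Matrix.ext fun i j => by simp [hB i j]) (fun x v => by
    have h := (hPSD x).dotProduct_mulVec_nonneg
      fun i => (v (.inl i) : ℂ) + Complex.I * (v (.inr i) : ℂ)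
    have h := (Complex.le_def.1 h).1
    simp only [dotProduct, mulVec, Finset.mul_sum, Complex.re_sum, Matrix.of_apply, hev] at h
    refine h.trans_eq ?_
    simp only [Fintype.sum_sum_type, Matrix.fromBlocks_apply₁₁, Matrix.fromBlocks_apply₁₂,
      Matrix.fromBlocks_apply₂₁, Matrix.fromBlocks_apply₂₂, ← Finset.sum_add_distrib]
    refine Finset.sum_congr rfl fun i _ => Finset.sum_congr rfl fun j _ => ?_
    simp
    ring)
  refine ⟨C √2 * s, mul_ne_zero (by simp) hs, k,
    fun i l => toℂ (N (.inl i) l) + C Complex.I * toℂ (N (.inr i) l), fun i j => ?_⟩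
  have h11 := congrArg toℂ (hN (.inl i) (.inl j))
  have h22 := congrArg toℂ (hN (.inr i) (.inr j))
  have h12 := congrArg toℂ (hN (.inl i) (.inr j))
  have h21 := congrArg toℂ (hN (.inr i) (.inl j))
  have hI : (C Complex.I : MvPolynomial (Fin d) ℂ) * C Complex.I = -1 := by
    rw [← map_mul, Complex.I_mul_I, map_neg, map_one]
  have h2 : (C ((√2 : ℝ) : ℂ) : MvPolynomial (Fin d) ℂ) ^ 2 = 2 := by
    rw [← map_pow, ← Complex.ofReal_pow, Real.sq_sqrt zero_le_two, Complex.ofReal_ofNat]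
    exact map_ofNat C 2
  simp only [Matrix.fromBlocks_apply₁₁, Matrix.fromBlocks_apply₁₂, Matrix.fromBlocks_apply₂₁,
    Matrix.fromBlocks_apply₂₂, toℂ, map_mul, map_pow, map_sum, map_neg, Matrix.of_apply,
    Matrix.neg_apply] at h11 h12 h21 h22
  have hterm : ∀ p q p' q' : MvPolynomial (Fin d) ℝ,
      (toℂ p + C Complex.I * toℂ q) * conjPoly (toℂ p' + C Complex.I * toℂ q') =
      toℂ p * toℂ p' + toℂ q * toℂ q' + C Complex.I * (toℂ q * toℂ p' - toℂ p * toℂ q') := by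
    intro p q p' q'
    rw [conjPoly_toℂ_add_I_mul_toℂ]
    linear_combination (-(toℂ q * toℂ q')) * hI
  simp only [hterm, Finset.sum_add_distrib, ← Finset.mul_sum, Finset.sum_sub_distrib, hF]
  simp only [toℂ, ← h11, ← h12, ← h21, ← h22, map_mul, map_C, Complex.coe_algebraMap]
  rw [mul_pow, h2]
  ring
end
end
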